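/- arXiv:2308.03677 — 2 statements merged into one kernel-verified Lean document; each statement's English description precedes it below -/
import Mathlib

section
/- The class K of finite connected open partial n-gons with strong embeddings ≤_o has the amalgamation property: if A ≤_o B₁ and A ≤_o B₂ with A, B₁, B₂ ∈ K, then there exists C ∈ K with strong embeddings of B₁ and B₂ into C agreeing on A. -/
open SimpleGraph

universe u

namespace GenPolygon

variable {V : Type u}

/-- A graph is bipartite if it admits a proper 2-colouring. -/
def IsBipartite (G : SimpleGraph V) : Prop :=
  ∃ c : V → Bool, ∀ ⦃x y⦄, G.Adj x y → c x ≠ c y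

/-- A weak generalized n-gon: bipartite, diameter n, girth 2n. -/
def IsWeakGenGon (n : ℕ) (G : SimpleGraph V) : Prop :=
  IsBipartite G ∧ G.ediam = (n : ℕ∞) ∧ G.egirth = (2 * n : ℕ∞)

/-- Thick: every vertex has at least 3 neighbours. -/
def Thick (G : SimpleGraph V) : Prop :=
  ∀ v : V, 3 ≤ (G.neighborSet v).ncard

/-- A generalized n-gon: a thick weak generalized n-gon. -/
def IsGenGon (n : ℕ) (G : SimpleGraph V) : Prop :=
  IsWeakGenGon n G ∧ Thick G

/-- A partial n-gon: connected bipartite graph of girth at least 2n. -/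
def IsPartialGon (n : ℕ) (G : SimpleGraph V) : Prop :=
  G.Connected ∧ IsBipartite G ∧ (2 * n : ℕ∞) ≤ G.egirth

/-- Valency of `v` inside the vertex set `A`. -/
noncomputable def degIn (G : SimpleGraph V) (A : Set V) (v : V) : ℕ :=
  (G.neighborSet v ∩ A).ncard

/-- Distance between `x` and `y` computed inside the induced subgraph on `S`. -/
noncomputable def edistIn (G : SimpleGraph V) (S : Set V) (x y : V) : ℕ∞ :=
  ⨅ p : {p : G.Walk x y // ∀ v ∈ p.support, v ∈ S}, ((p : G.Walk x y).length : ℕ∞)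

/-- `γ` is the interior of a clean arc inside `S` joining `x` and `y`:
a path of length `n-1` whose `n-2` interior vertices all have valency 2 in `S`. -/
def IsCleanArcIn (n : ℕ) (G : SimpleGraph V) (S : Set V) (x y : V) (γ : Set V) : Prop :=
  ∃ p : G.Walk x y, p.IsPath ∧ p.length = n - 1 ∧ (∀ v ∈ p.support, v ∈ S) ∧
    γ = {v | v ∈ p.support ∧ v ≠ x ∧ v ≠ y} ∧ ∀ v ∈ γ, degIn G S v = 2

/-- The finite subgraph on `A` has a loose end (vertex of valency ≤ 1 in `A`). -/
def HasLooseEnd (G : SimpleGraph V) (A : Set V) : Prop :=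
  ∃ v ∈ A, degIn G A v ≤ 1

/-- The subgraph on `A` contains a clean arch. -/
def HasCleanArch (n : ℕ) (G : SimpleGraph V) (A : Set V) : Prop :=
  ∃ x y γ, x ∈ A ∧ y ∈ A ∧ γ.Nonempty ∧ IsCleanArcIn n G A x y γ

/-- The subgraph on `B` is open: every finite nonempty subgraph has a loose end
or a clean arch. -/
def IsOpenSet (n : ℕ) (G : SimpleGraph V) (B : Set V) : Prop :=
  ∀ A ⊆ B, A.Finite → A.Nonempty → HasLooseEnd G A ∨ HasCleanArch n G A

/-- An open graph (e.g. an open generalized n-gon). -/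
def IsOpenGraph (n : ℕ) (G : SimpleGraph V) : Prop :=
  IsOpenSet n G Set.univ

/-- `B` is closed over `A`: `B ∩ A = ∅` and `B` contains neither a loose end
nor (the interior of) a clean arc with endpoints in `A ∪ B`. -/
def ClosedOver (n : ℕ) (G : SimpleGraph V) (A B : Set V) : Prop :=
  Disjoint A B ∧ B.Nonempty ∧
  (∀ v ∈ B, 2 ≤ degIn G (A ∪ B) v) ∧
  ¬ ∃ x y γ, x ∈ A ∪ B ∧ y ∈ A ∪ B ∧ γ ⊆ B ∧ γ.Nonempty ∧
      IsCleanArcIn n G (A ∪ B) x y γ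

/-- `B` is open over `A`: no finite subset of `B \ A` is closed over `A`. -/
def OpenOver (n : ℕ) (G : SimpleGraph V) (A B : Set V) : Prop :=
  ∀ D ⊆ B \ A, D.Finite → ¬ ClosedOver n G A D

/-- `A ≤ₒ B`: `A ⊆ B` and `B` is open over `A`. -/
def StrongleO (n : ℕ) (G : SimpleGraph V) (A B : Set V) : Prop :=
  A ⊆ B ∧ ∀ D ⊆ B \ A, D.Finite → ¬ ClosedOver n G A D

/-- `B` neighbours `A`: every vertex of `A` has a neighbour in `B \ A`. -/
def Neighbours (G : SimpleGraph V) (A B : Set V) : Prop :=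
  ∀ a ∈ A, ∃ b ∈ B \ A, G.Adj a b

/-- Edges of `G` lying inside the vertex set `A`. -/
def edgesIn (G : SimpleGraph V) (A : Set V) : Set (Sym2 V) :=
  {e ∈ G.edgeSet | ∀ v ∈ e, v ∈ A}

/-- Edges of `G` with one endpoint in `A` and one in `B`. -/
def crossEdges (G : SimpleGraph V) (A B : Set V) : Set (Sym2 V) :=
  {e ∈ G.edgeSet | ∃ x ∈ A, ∃ y ∈ B, e = s(x, y)}

/-- The rank function δₙ(A) = (n-1)|V(A)| - (n-2)|E(A)| (for finite `A`). -/
noncomputable def delta (n : ℕ) (G : SimpleGraph V) (A : Set V) : ℤ :=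
  ((n : ℤ) - 1) * (A.ncard : ℤ) - ((n : ℤ) - 2) * ((edgesIn G A).ncard : ℤ)

/-- `A` is n-strong in `B`: δₙ(X) ≥ δₙ(X ∩ A) for all finite X ⊆ B. -/
def NStrong (n : ℕ) (G : SimpleGraph V) (A B : Set V) : Prop :=
  A ⊆ B ∧ ∀ X ⊆ B, X.Finite → delta n G (X ∩ A) ≤ delta n G X

/-- `γ` is a clean arc freshly attached to `S` between `x, y ∈ S` at distance n+1. -/
def AttachedCleanArc (n : ℕ) (G : SimpleGraph V) (S : Set V) (x y : V) (γ : Set V) : Prop :=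
  x ∈ S ∧ y ∈ S ∧ edistIn G S x y = ((n : ℕ∞) + 1) ∧ Disjoint S γ ∧
  IsCleanArcIn n G (S ∪ γ) x y γ

/-- One step of the free completion: add a clean arc between every pair of
vertices at distance n+1, and nothing else. -/
def FreeStep (n : ℕ) (G : SimpleGraph V) (S T : Set V) : Prop :=
  S ⊆ T ∧
  (∀ x y, x ∈ S → y ∈ S → edistIn G S x y = ((n : ℕ∞) + 1) →
    ∃ γ ⊆ T, AttachedCleanArc n G S x y γ) ∧
  (∀ v ∈ T \ S, ∃ x y γ, v ∈ γ ∧ γ ⊆ T ∧ AttachedCleanArc n G S x y γ)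

/-- `Γ` is the chain of a free n-completion (of `Γ 0`) inside the ambient graph `G`. -/
def IsFreeCompletionChain (n : ℕ) (G : SimpleGraph V) (Γ : ℕ → Set V) : Prop :=
  ∀ i, FreeStep n G (Γ i) (Γ (i + 1))

/-- The sub-n-gon generated by `A`: intersection of all generalized sub-n-gons
of `G` containing `A`. -/
def genSubGon (n : ℕ) (G : SimpleGraph V) (A : Set V) : Set V :=
  ⋂₀ {S : Set V | A ⊆ S ∧ IsGenGon n (G.induce S)}

/-- Hyper-free minimal extension: add a loose end or a clean arc between two
vertices at distance n+1. -/
def HFMinExt (n : ℕ) (G : SimpleGraph V) (S T : Set V) : Prop :=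
  S ⊆ T ∧
  ((∃ v, v ∉ S ∧ T = insert v S ∧ degIn G T v ≤ 1) ∨
   (∃ x y, AttachedCleanArc n G S x y (T \ S)))

/-- Extension by a single clean arc. -/
def CleanArcStep (n : ℕ) (G : SimpleGraph V) (S T : Set V) : Prop :=
  S ⊆ T ∧ ∃ x y, AttachedCleanArc n G S x y (T \ S)

/-- `H` is a hat-rack of length `k`: a simple path `x₀, …, x_k` together with,
for each interior index `1 ≤ i ≤ k-1`, a set of extra neighbours of `xᵢ`. -/
def IsHatRack (n k : ℕ) (G : SimpleGraph V) (H : Set V) : Prop :=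
  ∃ x : Fin (k + 1) → V, Function.Injective x ∧
    (∀ i : Fin k, G.Adj (x i.castSucc) (x i.succ)) ∧
    (∀ i, x i ∈ H) ∧
    ∀ v ∈ H, (∀ i, v ≠ x i) →
      ∃ i : Fin (k + 1), 1 ≤ (i : ℕ) ∧ (i : ℕ) ≤ k - 1 ∧ G.neighborSet v ∩ H = {x i}

end GenPolygon

namespace GenPolygon

variable {V : Type u}

/-- `g 0, …, g m` is a path in `S` whose interior vertices lie in `D` and have no neighbours in
`S` apart from their two neighbours on the path. -/
def IsArc (m : ℕ) (G : SimpleGraph V) (S D : Set V) (g : ℕ → V) : Prop :=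
  (∀ i < m, G.Adj (g i) (g (i + 1))) ∧ Set.InjOn g (Set.Iic m) ∧ (∀ i ≤ m, g i ∈ S) ∧
    ∀ i, 0 < i → i < m → g i ∈ D ∧ ∀ w ∈ S, G.Adj (g i) w → w = g (i - 1) ∨ w = g (i + 1)

/-- All neighbours of `v` in `S` coincide. -/
def IsLoose (G : SimpleGraph V) (S : Set V) (v : V) : Prop :=
  ∀ w ∈ S, ∀ w' ∈ S, G.Adj v w → G.Adj v w' → w = w'

/-- `D` contains a loose end of `S` or the interior of a clean arc of `S`. -/
def Reducible (m : ℕ) (G : SimpleGraph V) (S D : Set V) : Prop :=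
  (∃ v ∈ D, IsLoose G S v) ∨ ∃ g, IsArc m G S D g

/-- Every nonempty set disjoint from `A` is reducible over `A`. -/
def IsStrong (m : ℕ) (G : SimpleGraph V) (A : Set V) : Prop :=
  ∀ D, Disjoint D A → D.Nonempty → Reducible m G (A ∪ D) D

section Reducibility

variable {m : ℕ} {G : SimpleGraph V} {S S' D D' : Set V} {g h : ℕ → V} {v : V}

lemma IsArc.adj_pred (hg : IsArc m G S D g) {i : ℕ} (h0 : 0 < i) (hi : i ≤ m) :
    G.Adj (g i) (g (i - 1)) := by
  have := hg.1 (i - 1) (by omega)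
  rw [Nat.sub_add_cancel h0] at this
  exact this.symm

lemma IsArc.eq_of_eq (hg : IsArc m G S D g) {i j : ℕ} (hi : i ≤ m) (hj : j ≤ m)
    (hij : g i = g j) : i = j :=
  hg.2.1 hi hj hij

lemma IsArc.mem_left (hg : IsArc m G S D g) {i : ℕ} (hi : i ≤ m) : g i ∈ S :=
  hg.2.2.1 i hi

lemma IsArc.mem_right (hg : IsArc m G S D g) {i : ℕ} (h0 : 0 < i) (hi : i < m) : g i ∈ D :=
  (hg.2.2.2 i h0 hi).1

lemma IsArc.eq_or_eq (hg : IsArc m G S D g) {i : ℕ} (h0 : 0 < i) (hi : i < m) {w : V}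
    (hw : w ∈ S) (ha : G.Adj (g i) w) : w = g (i - 1) ∨ w = g (i + 1) :=
  (hg.2.2.2 i h0 hi).2 w hw ha

lemma IsArc.mono_right (hg : IsArc m G S D g) (hD : D ⊆ D') : IsArc m G S D' g :=
  ⟨hg.1, hg.2.1, hg.2.2.1, fun i h0 hi => ⟨hD (hg.2.2.2 i h0 hi).1, (hg.2.2.2 i h0 hi).2⟩⟩

lemma IsArc.not_isLoose (hg : IsArc m G S D g) (hS : S ⊆ S') {i : ℕ} (h0 : 0 < i) (hi : i < m) :
    ¬ IsLoose G S' (g i) := fun hl => by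
  have := hg.eq_of_eq (i := i - 1) (j := i + 1) (by omega) (by omega)
    (hl _ (hS (hg.mem_left (by omega))) _ (hS (hg.mem_left (by omega)))
      (hg.adj_pred h0 hi.le) (hg.1 i hi))
  omega

lemma IsArc.reducible_of_subset (hg : IsArc m G S D g) (hS : S' ⊆ S) {k : ℕ} (h0 : 0 < k)
    (hk : k < m) (hkS : g k ∈ S') : Reducible m G S' (D ∩ S') := by
  by_cases hall : ∀ i ≤ m, g i ∈ S'
  · exact Or.inr ⟨g, hg.1, hg.2.1, hall, fun i hi0 him =>
      ⟨⟨hg.mem_right hi0 him, hall i him.le⟩, fun w hw => hg.eq_or_eq hi0 him (hS hw)⟩⟩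
  · push Not at hall
    obtain ⟨i, him, hi⟩ := hall
    left
    rcases lt_trichotomy i k with hik | rfl | hik
    · obtain ⟨j, hj, hj1, hjS, hj1S⟩ : ∃ j, i ≤ j ∧ j < k ∧ g j ∉ S' ∧ g (j + 1) ∈ S' := by
        by_contra! hcon
        have : ∀ d, i + d ≤ k → g (i + d) ∉ S' := fun d => by
          induction d with
          | zero => exact fun _ => hi
          | succ d ih => exact fun hd => hcon (i + d) (by omega) (by omega) (ih (by omega))
        exact this (k - i) (by omega) (by rwa [Nat.add_sub_cancel' hik.le])
      have key : ∀ w ∈ S', G.Adj (g (j + 1)) w → w = g (j + 1 + 1) := fun w hw ha => by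
        rcases hg.eq_or_eq (by omega) (by omega) (hS hw) ha with rfl | rfl
        · exact absurd hw hjS
        · rfl
      exact ⟨g (j + 1), ⟨hg.mem_right (by omega) (by omega), hj1S⟩,
        fun w hw w' hw' ha ha' => (key w hw ha).trans (key w' hw' ha').symm⟩
    · exact absurd hkS hi
    · obtain ⟨j, hj, hj1, hjS, hj1S⟩ : ∃ j, k ≤ j ∧ j < i ∧ g j ∈ S' ∧ g (j + 1) ∉ S' := by
        by_contra! hcon
        have : ∀ d, k + d ≤ i → g (k + d) ∈ S' := fun d => by
          induction d with
          | zero => exact fun _ => hkS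
          | succ d ih => exact fun hd => hcon (k + d) (by omega) (by omega) (ih (by omega))
        exact hi (by simpa [Nat.add_sub_cancel' hik.le] using this (i - k) (by omega))
      have key : ∀ w ∈ S', G.Adj (g j) w → w = g (j - 1) := fun w hw ha => by
        rcases hg.eq_or_eq (by omega) (by omega) (hS hw) ha with rfl | rfl
        · rfl
        · exact absurd hw hj1S
      exact ⟨g j, ⟨hg.mem_right (by omega) (by omega), hjS⟩,
        fun w hw w' hw' ha ha' => (key w hw ha).trans (key w' hw' ha').symm⟩

lemma IsLoose.mono (hv : IsLoose G S v) (hS : S' ⊆ S) : IsLoose G S' v :=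
  fun w hw w' hw' => hv w (hS hw) w' (hS hw')

lemma Reducible.mono_right (hr : Reducible m G S D) (hD : D ⊆ D') : Reducible m G S D' :=
  hr.imp (fun ⟨v, hv, hl⟩ => ⟨v, hD hv, hl⟩) fun ⟨g, hg⟩ => ⟨g, hg.mono_right hD⟩

lemma Reducible.restrict (hm : 2 ≤ m) (hr : Reducible m G S D) (hS : S' ⊆ S) (hD : D ⊆ S') :
    Reducible m G S' D := by
  rcases hr with ⟨v, hv, hl⟩ | ⟨g, hg⟩
  · exact Or.inl ⟨v, hv, hl.mono hS⟩
  · have h1 := hg.mem_right one_pos (by omega)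
    exact (hg.reducible_of_subset hS one_pos (by omega) (hD h1)).mono_right Set.inter_subset_left

/-- Enlarging `S` by vertices not adjacent to `D` preserves reducibility. -/
lemma Reducible.extend (hr : Reducible m G S D) (hS : S ⊆ S')
    (hSD : ∀ v ∈ D, ∀ w ∈ S', G.Adj v w → w ∈ S) : Reducible m G S' D := by
  rcases hr with ⟨v, hv, hl⟩ | ⟨g, hg⟩
  · exact Or.inl ⟨v, hv, fun w hw w' hw' ha ha' =>
      hl w (hSD v hv w hw ha) w' (hSD v hv w' hw' ha') ha ha'⟩
  · refine Or.inr ⟨g, hg.1, hg.2.1, fun i hi => hS (hg.mem_left hi), fun i h0 hi =>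
      ⟨hg.mem_right h0 hi, fun w hw ha => hg.eq_or_eq h0 hi ?_ ha⟩⟩
    exact hSD _ (hg.mem_right h0 hi) w hw ha

variable {W : Type u} {H : SimpleGraph W}

lemma Reducible.map (f : G ↪g H) (hr : Reducible m G S D) :
    Reducible m H (f '' S) (f '' D) := by
  rcases hr with ⟨v, hv, hl⟩ | ⟨g, hg⟩
  · refine Or.inl ⟨f v, ⟨v, hv, rfl⟩, ?_⟩
    rintro _ ⟨w, hw, rfl⟩ _ ⟨w', hw', rfl⟩ ha ha'
    rw [f.map_adj_iff] at ha ha'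
    rw [hl w hw w' hw' ha ha']
  · refine Or.inr ⟨fun i => f (g i), fun i hi => f.map_adj_iff.2 (hg.1 i hi),
      fun i hi j hj hij => hg.2.1 hi hj (f.injective hij),
      fun i hi => ⟨_, hg.mem_left hi, rfl⟩, fun i h0 hi => ⟨⟨_, hg.mem_right h0 hi, rfl⟩, ?_⟩⟩
    rintro _ ⟨w, hw, rfl⟩ ha
    exact (hg.eq_or_eq h0 hi hw (f.map_adj_iff.1 ha)).imp (congrArg f) (congrArg f)

lemma Reducible.of_map (f : G ↪g H) (hr : Reducible m H (f '' S) (f '' D)) :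
    Reducible m G S D := by
  rcases hr with ⟨_, ⟨v, hv, rfl⟩, hl⟩ | ⟨g, hg⟩
  · exact Or.inl ⟨v, hv, fun w hw w' hw' ha ha' => f.injective
      (hl _ ⟨w, hw, rfl⟩ _ ⟨w', hw', rfl⟩ (f.map_adj_iff.2 ha) (f.map_adj_iff.2 ha'))⟩
  · have hex : ∀ i, ∃ a, i ≤ m → a ∈ S ∧ f a = g i := fun i => by
      by_cases hi : i ≤ m
      · obtain ⟨a, ha, hag⟩ := hg.mem_left hi
        exact ⟨a, fun _ => ⟨ha, hag⟩⟩
      · obtain ⟨a, -, -⟩ := hg.mem_left m.zero_le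
        exact ⟨a, fun h => absurd h hi⟩
    choose g' hg' using hex
    refine Or.inr ⟨g', fun i hi => ?_, fun i hi j hj hij => ?_, fun i hi => (hg' i hi).1,
      fun i h0 hi => ⟨?_, fun w hw ha => ?_⟩⟩
    · rw [← f.map_adj_iff, (hg' i hi.le).2, (hg' (i + 1) hi).2]
      exact hg.1 i hi
    · exact hg.eq_of_eq hi hj (by rw [← (hg' i hi).2, ← (hg' j hj).2, hij])
    · obtain ⟨d, hd, hdg⟩ := hg.mem_right h0 hi
      rwa [← f.injective (hdg.trans (hg' i hi.le).2.symm)]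
    · rw [← f.map_adj_iff, (hg' i hi.le).2] at ha
      refine (hg.eq_or_eq h0 hi ⟨w, hw, rfl⟩ ha).imp (fun e => ?_) fun e => ?_
      · exact f.injective (e.trans (hg' (i - 1) (by omega)).2.symm)
      · exact f.injective (e.trans (hg' (i + 1) hi).2.symm)

lemma IsStrong.trans (hm : 2 ≤ m) (f : G ↪g H) {A : Set V} (hA : IsStrong m G A)
    (hf : IsStrong m H (Set.range f)) : IsStrong m H (f '' A) := by
  intro D hDA hD
  by_cases hD' : (D \ Set.range f).Nonempty
  · refine Reducible.mono_right ?_ (Set.sdiff_subset (t := Set.range f))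
    refine (hf _ Set.disjoint_sdiff_left hD').restrict hm ?_
      (Set.sdiff_subset.trans Set.subset_union_right)
    rintro x (⟨a, -, rfl⟩ | hx)
    · exact Or.inl ⟨a, rfl⟩
    · by_cases hxf : x ∈ Set.range f
      · exact Or.inl hxf
      · exact Or.inr ⟨hx, hxf⟩
  · rw [Set.not_nonempty_iff_eq_empty, Set.sdiff_eq_empty] at hD'
    obtain ⟨E, rfl⟩ := Set.subset_range_iff_exists_image_eq.1 hD'
    rw [← Set.image_union]
    exact (hA E ((Set.disjoint_image_iff f.injective).1 hDA) hD.of_image).map f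

lemma IsStrong.of_map (f : G ↪g H) {A : Set V} (hA : IsStrong m H (f '' A)) :
    IsStrong m G A := fun D hDA hD => Reducible.of_map f <| by
  rw [Set.image_union]
  exact hA _ ((Set.disjoint_image_iff f.injective).2 hDA) (hD.image f)

/-- Interiors of arcs have the same size, so containment implies equality. -/
lemma eq_and_exists_eq_of_interior_subset {L : ℕ} (hLm : L ≤ m) (hm : 2 ≤ m)
    (hg : Set.InjOn g (Set.Iic m))
    (hsub : ∀ k, 0 < k → k < m → ∃ i, 0 < i ∧ i < L ∧ g k = h i) :
    L = m ∧ ∀ i, 0 < i → i < L → ∃ k, 0 < k ∧ k < m ∧ h i = g k := by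
  classical
  have hgc : ((Finset.Ioo 0 m).image g).card = m - 1 := by
    rw [Finset.card_image_of_injOn (hg.mono fun i hi => ?_), Nat.card_Ioo, Nat.sub_zero]
    rw [Finset.coe_Ioo] at hi
    exact hi.2.le
  have hhc : ((Finset.Ioo 0 L).image h).card ≤ L - 1 :=
    Finset.card_image_le.trans (by simp)
  have hss : (Finset.Ioo 0 m).image g ⊆ (Finset.Ioo 0 L).image h := fun x hx => by
    obtain ⟨k, hk, rfl⟩ := Finset.mem_image.1 hx
    rw [Finset.mem_Ioo] at hk
    obtain ⟨i, h0, hi, e⟩ := hsub k hk.1 hk.2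
    exact Finset.mem_image.2 ⟨i, Finset.mem_Ioo.2 ⟨h0, hi⟩, e.symm⟩
  have hle := Finset.card_le_card hss
  obtain rfl : L = m := by omega
  refine ⟨rfl, fun i h0 hi => ?_⟩
  have := Finset.eq_of_subset_of_card_le hss (by omega)
  have hmem : h i ∈ (Finset.Ioo 0 L).image g := by
    rw [this]
    exact Finset.mem_image_of_mem _ (Finset.mem_Ioo.2 ⟨h0, hi⟩)
  obtain ⟨k, hk, e⟩ := Finset.mem_image.1 hmem
  rw [Finset.mem_Ioo] at hk
  exact ⟨k, hk.1, hk.2, e.symm⟩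

/-- Adding a clean arc to a strong set gives a strong set. -/
lemma IsStrong.union_arc (hm : 2 ≤ m) {A : Set V} (hA : IsStrong m G A)
    (hD : ∀ v ∈ D, ∃ i, 0 < i ∧ i < m ∧ v = g i) (hg : IsArc m G (A ∪ D) D g)
    (hDA : Disjoint D A) : IsStrong m G (A ∪ D) := by
  intro E hE hEne
  have hEA : Disjoint E A := hE.mono_right Set.subset_union_left
  have hES : ∀ x ∈ E, x ∉ A ∪ D := fun x hx => Set.disjoint_left.1 hE hx
  by_cases hcon : ∃ i, (0 < i ∧ i < m) ∧ ∃ e ∈ E, G.Adj (g i) e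
  · obtain ⟨i, ⟨hi0, him⟩, e, he, hie⟩ := hcon
    have hr := hA (D ∪ E) (hDA.union_left hEA) (hEne.mono Set.subset_union_right)
    rw [← Set.union_assoc] at hr
    rcases hr with ⟨v, hv | hv, hl⟩ | ⟨k, hk⟩
    · obtain ⟨j, hj0, hjm, rfl⟩ := hD v hv
      exact absurd hl (hg.not_isLoose Set.subset_union_left hj0 hjm)
    · exact Or.inl ⟨v, hv, hl⟩
    · by_cases hall : ∀ j, 0 < j → j < m → k j ∈ E
      · exact Or.inr ⟨k, hk.1, hk.2.1, hk.2.2.1, fun j h0 hj =>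
          ⟨hall j h0 hj, fun w => hk.eq_or_eq h0 hj⟩⟩
      · have hnb : ∀ j, 0 < j → j < m → k j ∈ D → ∀ w ∈ E, ¬ G.Adj (k j) w := by
          intro j hj0 hjm hjD w hw ha
          obtain ⟨l, hl0, hlm, hkl⟩ := hD _ hjD
          have h1 : g (l - 1) ∈ A ∪ D := hg.mem_left (by omega)
          have h2 : g (l + 1) ∈ A ∪ D := hg.mem_left hlm
          have hne : g (l - 1) ≠ g (l + 1) := fun e => by
            have := hg.eq_of_eq (by omega) hlm e
            omega
          have hw' := hk.eq_or_eq hj0 hjm (Or.inr hw) ha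
          have h1' := hk.eq_or_eq hj0 hjm (Or.inl h1) (hkl ▸ hg.adj_pred hl0 hlm.le)
          have h2' := hk.eq_or_eq hj0 hjm (Or.inl h2) (hkl ▸ hg.1 l hlm)
          have hn1 : g (l - 1) ≠ w := fun e => hES w hw (e ▸ h1)
          have hn2 : g (l + 1) ≠ w := fun e => hES w hw (e ▸ h2)
          grind
        push Not at hall
        obtain ⟨j, hj0, hjm, hjE⟩ := hall
        have hjD : k j ∈ D := (hk.mem_right hj0 hjm).resolve_right hjE
        have hup : ∀ d, j + d < m → k (j + d) ∈ D := fun d => by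
          induction d with
          | zero => exact fun _ => hjD
          | succ d ih =>
            exact fun hd => (hk.mem_right (by omega) hd).resolve_right fun hE' =>
              hnb (j + d) (by omega) (by omega) (ih (by omega)) _ hE' (hk.1 _ (by omega))
        have hdown : ∀ d, d < j → k (j - d) ∈ D := fun d => by
          induction d with
          | zero => exact fun _ => hjD
          | succ d ih =>
            exact fun hd => (hk.mem_right (by omega) (by omega)).resolve_right fun hE' =>
              hnb (j - d) (by omega) (by omega) (ih (by omega)) _ hE'
                (hk.adj_pred (by omega) (by omega))
        have hallD : ∀ l, 0 < l → l < m → k l ∈ D := fun l hl0 hlm => by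
          rcases le_total j l with hjl | hjl
          · simpa [Nat.add_sub_cancel' hjl] using hup (l - j) (by omega)
          · simpa [Nat.sub_sub_self hjl] using hdown (j - l) (by omega)
        obtain ⟨-, hcov⟩ := eq_and_exists_eq_of_interior_subset (h := g) le_rfl hm hk.2.1
          fun l hl0 hlm => hD _ (hallD l hl0 hlm)
        obtain ⟨l, hl0, hlm, hil⟩ := hcov i hi0 him
        exact absurd (hil ▸ hie) (hnb l hl0 hlm (hallD l hl0 hlm) e he)
  · push Not at hcon
    rw [Set.union_right_comm]
    refine (hA E hEA hEne).extend Set.subset_union_left fun v hv w hw ha => hw.resolve_right ?_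
    intro hwD
    obtain ⟨i, hi0, him, rfl⟩ := hD w hwD
    exact hcon i ⟨hi0, him⟩ v hv ha.symm

end Reducibility

section Translation

variable {n m : ℕ} {G : SimpleGraph V} {S D : Set V}

lemma exists_walk_getVert_eq : ∀ (m : ℕ) (g : ℕ → V), (∀ i < m, G.Adj (g i) (g (i + 1))) →
    ∃ p : G.Walk (g 0) (g m), p.length = m ∧ (∀ i ≤ m, p.getVert i = g i) ∧
      ∀ e ∈ p.edges, ∃ i < m, e = s(g i, g (i + 1)) := by
  intro m
  induction m with
  | zero => exact fun g _ => ⟨.nil, rfl, by simp, by simp⟩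
  | succ m ih =>
    intro g hg
    obtain ⟨p, hp, hv, he⟩ := ih (fun i => g (i + 1)) fun i hi => hg (i + 1) (by omega)
    refine ⟨.cons (hg 0 (by omega)) p, by simp [hp], fun i hi => ?_, fun e hmem => ?_⟩
    · cases i with
      | zero => simp
      | succ i => exact hv i (by omega)
    · rw [Walk.edges_cons, List.mem_cons] at hmem
      rcases hmem with rfl | hmem
      · exact ⟨0, by omega, rfl⟩
      · obtain ⟨i, hi, rfl⟩ := he e hmem
        exact ⟨i + 1, by omega, rfl⟩

lemma exists_cleanArcIn_iff [Finite V] (hn : 3 ≤ n) :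
    (∃ x y γ, x ∈ S ∧ y ∈ S ∧ γ ⊆ D ∧ γ.Nonempty ∧ IsCleanArcIn n G S x y γ) ↔
      ∃ g, IsArc (n - 1) G S D g := by
  constructor
  · rintro ⟨x, y, γ, -, -, hγD, -, p, hp, hlen, hpS, rfl, hdeg⟩
    have hinj := hp.getVert_injOn
    rw [hlen] at hinj
    replace hinj : ∀ i j, i ≤ n - 1 → j ≤ n - 1 → p.getVert i = p.getVert j → i = j :=
      fun i j hi hj => hinj hi hj
    have hint : ∀ i, 0 < i → i < n - 1 →
        p.getVert i ∈ {v | v ∈ p.support ∧ v ≠ x ∧ v ≠ y} := fun i h0 hi =>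
      ⟨p.getVert_mem_support i, fun e => by
        have := hinj i 0 hi.le (Nat.zero_le _) (e.trans p.getVert_zero.symm)
        omega, fun e => by
        have := hinj i (n - 1) hi.le le_rfl
          (e.trans (hlen ▸ p.getVert_length.symm))
        omega⟩
    have hadj : ∀ i < n - 1, G.Adj (p.getVert i) (p.getVert (i + 1)) := fun i hi =>
      p.adj_getVert_succ (hlen.symm ▸ hi)
    refine ⟨p.getVert, hadj, fun i hi j hj => hinj i j hi hj,
      fun i _ => hpS _ (p.getVert_mem_support i), fun i h0 hi => ⟨hγD (hint i h0 hi), ?_⟩⟩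
    intro w hw ha
    obtain ⟨a, b, -, hab⟩ := Set.ncard_eq_two.1 (hdeg _ (hint i h0 hi))
    have h1 : p.getVert (i - 1) ∈ G.neighborSet (p.getVert i) ∩ S := by
      refine ⟨?_, hpS _ (p.getVert_mem_support _)⟩
      have := hadj (i - 1) (by omega)
      rw [Nat.sub_add_cancel h0] at this
      exact this.symm
    have h2 : p.getVert (i + 1) ∈ G.neighborSet (p.getVert i) ∩ S :=
      ⟨hadj i hi, hpS _ (p.getVert_mem_support _)⟩
    have h3 : w ∈ G.neighborSet (p.getVert i) ∩ S := ⟨ha, hw⟩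
    have hne : p.getVert (i - 1) ≠ p.getVert (i + 1) := fun e => by
      have := hinj (i - 1) (i + 1) (by omega) hi e
      omega
    rw [hab] at h1 h2 h3
    simp only [Set.mem_insert_iff, Set.mem_singleton_iff] at h1 h2 h3
    grind
  · rintro ⟨g, hg⟩
    obtain ⟨p, hlen, hv, -⟩ := exists_walk_getVert_eq (n - 1) g hg.1
    have hsupp : ∀ v ∈ p.support, ∃ i ≤ n - 1, v = g i := fun v hvp => by
      obtain ⟨i, rfl, hi⟩ := Walk.mem_support_iff_exists_getVert.1 hvp
      exact ⟨i, hlen ▸ hi, hv i (hlen ▸ hi)⟩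
    have hint : ∀ v ∈ {v | v ∈ p.support ∧ v ≠ g 0 ∧ v ≠ g (n - 1)},
        ∃ i, 0 < i ∧ i < n - 1 ∧ v = g i := by
      rintro v ⟨hvp, h0, h1⟩
      obtain ⟨i, hi, rfl⟩ := hsupp v hvp
      refine ⟨i, Nat.pos_of_ne_zero ?_, lt_of_le_of_ne hi ?_, rfl⟩
      · rintro rfl
        exact h0 rfl
      · rintro rfl
        exact h1 rfl
    refine ⟨g 0, g (n - 1), _, hg.mem_left (Nat.zero_le _), hg.mem_left le_rfl, ?_, ?_,
      p, ?_, hlen, ?_, rfl, ?_⟩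
    · intro v hvγ
      obtain ⟨i, h0, hi, rfl⟩ := hint v hvγ
      exact hg.mem_right h0 hi
    · refine ⟨g 1, ?_, fun e => ?_, fun e => ?_⟩
      · rw [← hv 1 (by omega)]
        exact p.getVert_mem_support 1
      · have := hg.eq_of_eq (by omega) (by omega) e
        omega
      · have := hg.eq_of_eq (by omega) (by omega) e
        omega
    · rw [← Walk.IsPath.getVert_injOn_iff, hlen]
      intro i hi j hj hij
      exact hg.eq_of_eq hi hj (by rw [← hv i hi, ← hv j hj, hij])
    · intro v hvp
      obtain ⟨i, hi, rfl⟩ := hsupp v hvp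
      exact hg.mem_left hi
    · intro v hvγ
      obtain ⟨i, h0, hi, rfl⟩ := hint v hvγ
      refine Set.ncard_eq_two.2 ⟨g (i - 1), g (i + 1), fun e => ?_, ?_⟩
      · have := hg.eq_of_eq (by omega) (by omega) e
        omega
      · ext w
        simp only [Set.mem_inter_iff, mem_neighborSet, Set.mem_insert_iff,
          Set.mem_singleton_iff]
        constructor
        · exact fun h => hg.eq_or_eq h0 hi h.2 h.1
        · rintro (rfl | rfl)
          · exact ⟨hg.adj_pred h0 hi.le, hg.mem_left (by omega)⟩
          · exact ⟨hg.1 i hi, hg.mem_left (by omega)⟩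

lemma degIn_le_one_iff [Finite V] {v : V} : degIn G S v ≤ 1 ↔ IsLoose G S v := by
  rw [degIn, Set.ncard_le_one (Set.toFinite _)]
  exact ⟨fun h w hw w' hw' ha ha' => h w ⟨ha, hw⟩ w' ⟨ha', hw'⟩,
    fun h w hw w' hw' => h w hw.2 w' hw'.2 hw.1 hw'.1⟩

lemma strongleO_univ_iff [Finite V] (hn : 3 ≤ n) {A : Set V} :
    StrongleO n G A Set.univ ↔ IsStrong (n - 1) G A := by
  have key : ∀ D, Disjoint D A → D.Nonempty →
      (¬ ClosedOver n G A D ↔ Reducible (n - 1) G (A ∪ D) D) := by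
    intro D hDA hD
    rw [ClosedOver, Reducible, exists_cleanArcIn_iff hn]
    simp only [← degIn_le_one_iff, hDA.symm, hD, true_and, not_and_or, not_not, not_forall,
      not_le, Nat.lt_succ_iff, exists_prop]
  refine ⟨fun h D hDA hD => (key D hDA hD).1 (h.2 D ?_ D.toFinite), fun h =>
    ⟨Set.subset_univ A, fun D _ _ hc => (key D hc.1.symm hc.2.1).2 (h D hc.1.symm hc.2.1) hc⟩⟩
  exact fun x hx => ⟨trivial, Set.disjoint_left.1 hDA hx⟩

lemma isOpenGraph_iff [Finite V] (hn : 3 ≤ n) :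
    IsOpenGraph n G ↔ IsStrong (n - 1) G ∅ := by
  have key : ∀ D, (HasLooseEnd G D ∨ HasCleanArch n G D ↔ Reducible (n - 1) G (∅ ∪ D) D) := by
    intro D
    rw [Reducible, Set.empty_union, ← exists_cleanArcIn_iff hn, HasLooseEnd, HasCleanArch]
    simp only [degIn_le_one_iff]
    refine or_congr_right ⟨?_, ?_⟩
    · rintro ⟨x, y, γ, hx, hy, hγ, h⟩
      refine ⟨x, y, γ, hx, hy, ?_, hγ, h⟩
      obtain ⟨p, -, -, hp, rfl, -⟩ := h
      exact fun v hv => hp v hv.1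
    · rintro ⟨x, y, γ, hx, hy, -, hγ, h⟩
      exact ⟨x, y, γ, hx, hy, hγ, h⟩
  exact ⟨fun h D _ hD => (key D).1 (h D (Set.subset_univ D) D.toFinite hD),
    fun h D _ _ hD => (key D).2 (h D (Set.disjoint_empty D) hD)⟩

end Translation

section Walks

variable {W : Type u} {m : ℕ} {G : SimpleGraph V} {H : SimpleGraph W}

lemma even_length_iff {c : V → Bool} (hc : ∀ ⦃x y⦄, G.Adj x y → c x ≠ c y) {x y : V}
    (p : G.Walk x y) : Even p.length ↔ c x = c y := by
  induction p with
  | nil => simp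
  | @cons a b d h p ih =>
    have := hc h
    rw [Walk.length_cons, Nat.even_add_one, ih]
    cases ha : c a <;> cases hb : c b <;> cases hd : c d <;> simp_all

lemma abs_sub_le_length {φ : V → ℤ} {e : Sym2 V}
    (hφ : ∀ a b, G.Adj a b → s(a, b) ≠ e → |φ a - φ b| ≤ 1) {a b : V} (p : G.Walk a b)
    (he : e ∉ p.edges) : |φ a - φ b| ≤ p.length := by
  induction p with
  | nil => simp
  | @cons a b d h p ih =>
    rw [Walk.edges_cons, List.mem_cons, not_or] at he
    have h1 := hφ _ _ h (Ne.symm he.1)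
    have h2 := ih he.2
    have := abs_sub_le (φ a) (φ b) (φ d)
    push_cast [Walk.length_cons]
    linarith

lemma le_length_add_abs_sub {φ : V → ℤ} {u v : V} {K : ℕ} (hK : K ≤ |φ u - φ v|)
    (hφ : ∀ a b, G.Adj a b → s(a, b) ≠ s(u, v) → |φ a - φ b| ≤ 1) {a b : V} (p : G.Walk a b)
    (hp : p.edges.Nodup) (he : s(u, v) ∈ p.edges) : K + 1 ≤ p.length + |φ a - φ b| := by
  induction p with
  | nil => simp at he
  | @cons a b d h p ih =>
    rw [Walk.edges_cons, List.nodup_cons] at hp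
    push_cast [Walk.length_cons]
    by_cases hab : s(a, b) = s(u, v)
    · have h2 := abs_sub_le_length hφ p (hab ▸ hp.1)
      have h3 : (K : ℤ) ≤ |φ a - φ b| := by
        rcases Sym2.eq_iff.1 hab with ⟨rfl, rfl⟩ | ⟨rfl, rfl⟩
        · exact hK
        · rwa [abs_sub_comm]
      have := abs_sub_le (φ a) (φ d) (φ b)
      rw [abs_sub_comm (φ d)] at this
      linarith
    · rw [Walk.edges_cons, List.mem_cons] at he
      have h1 := ih hp.2 (he.resolve_left (Ne.symm hab))
      have h2 := hφ _ _ h hab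
      have := abs_sub_le (φ b) (φ a) (φ d)
      rw [abs_sub_comm (φ b) (φ a)] at this
      linarith

/-- If every edge outside the image of `f` has endpoints far apart in its complement, as witnessed
by a potential, then `H` inherits the girth bound of `G`. -/
lemma le_egirth_of_potential (f : G ↪g H) {K : ℕ} (hG : ((K + 1 : ℕ) : ℕ∞) ≤ G.egirth)
    (hH : ∀ u v, H.Adj u v → u ∉ Set.range f → ∃ φ : W → ℤ, K ≤ |φ u - φ v| ∧
      ∀ a b, H.Adj a b → s(a, b) ≠ s(u, v) → |φ a - φ b| ≤ 1) :
    ((K + 1 : ℕ) : ℕ∞) ≤ H.egirth := by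
  rw [le_egirth]
  intro z w hw
  by_cases hs : ∀ x ∈ w.support, x ∈ Set.range f
  · have hcont : H.induce (Set.range f) ⊑ G := by
      have hinj : Function.Injective fun x : Set.range f => x.2.choose := fun x y hxy => by
        ext
        rw [← x.2.choose_spec, ← y.2.choose_spec]
        exact congrArg f hxy
      refine ⟨⟨⟨fun x => x.2.choose, fun {x y} hxy => ?_⟩, hinj⟩⟩
      rw [← f.map_adj_iff, x.2.choose_spec, y.2.choose_spec]
      exact hxy
    have hcyc : (w.induce _ hs).IsCycle := by
      refine (Walk.isCycle_map_iff_of_injective (f := (Embedding.induce (Set.range f)).toHom)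
        (Embedding.induce (G := H) (Set.range f)).injective).1 ?_
      exact (Walk.map_induce w hs).symm ▸ hw
    have hlen : (w.induce _ hs).length = w.length :=
      (Walk.length_map _ _).symm.trans (congrArg Walk.length (Walk.map_induce w hs))
    rw [← hlen]
    exact (hG.trans hcont.egirth_le).trans (egirth_le_length hcyc)
  · push Not at hs
    obtain ⟨u, hu, huf⟩ := hs
    obtain ⟨v, huv⟩ : ∃ v, s(u, v) ∈ w.edges := by
      obtain ⟨e, he, hue⟩ := (Walk.mem_support_iff_exists_mem_edges_of_not_nil hw.not_nil).1 hu
      obtain ⟨v, rfl⟩ := hue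
      exact ⟨v, he⟩
    obtain ⟨φ, hK, hφ⟩ := hH u v (w.adj_of_mem_edges huv) huf
    have := le_length_add_abs_sub hK hφ w hw.edges_nodup huv
    rw [sub_self, abs_zero, add_zero] at this
    exact_mod_cast this

lemma le_length_add_one_of_le_egirth {N : ℕ∞} (hN : N ≤ G.egirth) {u v : V} (huv : G.Adj u v)
    (p : G.Walk v u) (hp : s(u, v) ∉ p.edges) : N ≤ (p.length + 1 : ℕ) := by
  classical
  have hc : (Walk.cons huv p.bypass).IsCycle := (Walk.cons_isCycle_iff _ _).2
    ⟨p.bypass_isPath, fun h => hp (p.edges_bypass_subset_edges h)⟩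
  refine (hN.trans (egirth_le_length hc)).trans ?_
  rw [Walk.length_cons]
  exact_mod_cast Nat.succ_le_succ p.length_bypass_le_length

lemma exists_distance_potential {x y : V} {N : ℕ} (h : ∀ p : G.Walk x y, N ≤ p.length) :
    ∃ d : V → ℤ, d x = 0 ∧ d y = N ∧ ∀ a b, G.Adj a b → |d a - d b| ≤ 1 := by
  have hstep : ∀ a b, G.Adj a b →
      (min (G.edist x b) N).toNat ≤ (min (G.edist x a) N).toNat + 1 := by
    intro a b hab
    have hfin : min (G.edist x a) N ≠ ⊤ :=
      ((min_le_right _ _).trans_lt (ENat.natCast_lt_top N)).ne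
    have h1 : G.edist x b ≤ G.edist x a + 1 :=
      G.edist_triangle.trans (add_le_add_right (edist_eq_one_iff_adj.2 hab).le _)
    have h2 : min (G.edist x b) N ≤ min (G.edist x a) N + 1 := by
      rcases min_cases (G.edist x a) N with ⟨h, -⟩ | ⟨h, -⟩ <;> rw [h]
      · exact (min_le_left _ _).trans h1
      · exact (min_le_right _ _).trans le_self_add
    have := ENat.toNat_le_toNat h2 (by simp)
    rwa [ENat.toNat_add hfin (by simp)] at this
  refine ⟨fun b => (min (G.edist x b) N).toNat, by simp, ?_, fun a b hab => ?_⟩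
  · have : (N : ℕ∞) ≤ G.edist x y := le_iInf fun p => by exact_mod_cast h p
    simp [min_eq_right this]
  · have h1 := hstep a b hab
    have h2 := hstep b a hab.symm
    rw [abs_le]
    constructor <;> dsimp only <;> omega

/-- A short walk between vertices of a strong subgraph either can be replaced by one inside the
subgraph or is a clean arc over it. -/
lemma IsStrong.exists_walk_or_arc (hm : 2 ≤ m) (f : G ↪g H) (hf : IsStrong m H (Set.range f)) :
    ∀ (L : ℕ) (a b : V) (p : H.Walk (f a) (f b)), p.length = L → L ≤ m →
      (∃ q : G.Walk a b, q.length ≤ L) ∨ (L = m ∧ ∃ g D, g 0 = f a ∧ g m = f b ∧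
        Disjoint D (Set.range f) ∧ (∀ v ∈ D, ∃ i, 0 < i ∧ i < m ∧ v = g i) ∧
        IsArc m H (Set.range f ∪ D) D g) := by
  classical
  intro L
  induction L using Nat.strong_induction_on with
  | h L ih =>
  intro a b p hL hLm
  by_cases hlt : p.bypass.length < L
  · rcases ih _ hlt a b p.bypass rfl (by omega) with ⟨q, hq⟩ | ⟨h, -⟩
    · exact Or.inl ⟨q, by omega⟩
    · omega
  have hpath : p.IsPath := by
    rw [← p.bypass_eq_self_of_length_le_length_bypass (by omega)]
    exact p.bypass_isPath
  by_cases hint : ∃ i, 0 < i ∧ i < L ∧ p.getVert i ∈ Set.range f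
  · obtain ⟨i, h0, hi, c, hc⟩ := hint
    left
    have h1 := ih i hi a c ((p.take i).copy rfl hc.symm)
      (by rw [Walk.length_copy, Walk.take_length]; omega) (by omega)
    have h2 := ih (L - i) (by omega) c b ((p.drop i).copy hc.symm rfl)
      (by rw [Walk.length_copy, Walk.drop_length]; omega) (by omega)
    rcases h1 with ⟨q₁, hq₁⟩ | ⟨h, -⟩
    · rcases h2 with ⟨q₂, hq₂⟩ | ⟨h, -⟩
      · exact ⟨q₁.append q₂, by rw [Walk.length_append]; omega⟩
      · omega
    · omega
  push Not at hint
  have hadj : ∀ i < L, H.Adj (p.getVert i) (p.getVert (i + 1)) := fun i hi =>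
    p.adj_getVert_succ (hL.symm ▸ hi)
  have hadj' : ∀ i, 0 < i → i < L → H.Adj (p.getVert i) (p.getVert (i - 1)) := fun i h0 hi => by
    have := hadj (i - 1) (by omega)
    rw [Nat.sub_add_cancel h0] at this
    exact this.symm
  have hinj : ∀ i j, i ≤ L → j ≤ L → p.getVert i = p.getVert j → i = j := fun i j hi hj =>
    hpath.getVert_injOn (hL.symm ▸ hi) (hL.symm ▸ hj)
  have hend : p.getVert L = f b := hL ▸ p.getVert_length
  rcases Nat.lt_or_ge L 2 with hL2 | hL2
  · left
    obtain rfl | rfl : L = 0 ∨ L = 1 := by omega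
    · obtain rfl : a = b := f.injective (Walk.eq_of_length_eq_zero hL)
      exact ⟨.nil, le_rfl⟩
    · have := hadj 0 one_pos
      rw [zero_add, hend, p.getVert_zero, f.map_adj_iff] at this
      exact ⟨this.toWalk, by simp⟩
  right
  set D : Set W := {v | ∃ i, 0 < i ∧ i < L ∧ v = p.getVert i} with hDdef
  have hDf : Disjoint D (Set.range f) := Set.disjoint_left.2 fun v hv hvf => by
    obtain ⟨i, h0, hi, rfl⟩ := hv
    exact hint i h0 hi hvf
  have hmem : ∀ i ≤ L, p.getVert i ∈ Set.range f ∪ D := fun i hi => by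
    rcases Nat.eq_zero_or_pos i with rfl | h0
    · exact Or.inl ⟨a, p.getVert_zero.symm⟩
    · rcases hi.eq_or_lt with rfl | hi
      · exact Or.inl ⟨b, hend.symm⟩
      · exact Or.inr ⟨i, h0, hi, rfl⟩
  rcases hf D hDf ⟨_, 1, one_pos, by omega, rfl⟩ with ⟨v, ⟨i, h0, hi, rfl⟩, hl⟩ | ⟨g, hg⟩
  · have := hinj (i - 1) (i + 1) (by omega) hi (hl _ (hmem _ (by omega)) _ (hmem _ hi)
      (hadj' i h0 hi) (hadj i hi))
    omega
  obtain ⟨rfl, hcov⟩ := eq_and_exists_eq_of_interior_subset (h := p.getVert) hLm hm hg.2.1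
    fun k hk0 hkm => hg.mem_right hk0 hkm
  refine ⟨rfl, p.getVert, D, p.getVert_zero, hend, hDf, fun v hv => hv, hadj,
    fun i hi j hj => hinj i j hi hj, hmem, fun i h0 hi => ⟨⟨i, h0, hi, rfl⟩, fun w hw ha => ?_⟩⟩
  obtain ⟨k, hk0, hkm, hk⟩ := hcov i h0 hi
  have h1 := hg.eq_or_eq hk0 hkm (hmem (i - 1) (by omega)) (hk ▸ hadj' i h0 hi)
  have h2 := hg.eq_or_eq hk0 hkm (hmem (i + 1) hi) (hk ▸ hadj i hi)
  have h3 := hg.eq_or_eq hk0 hkm hw (hk ▸ ha)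
  have hne : p.getVert (i - 1) ≠ p.getVert (i + 1) := fun e => by
    have := hinj _ _ (by omega) hi e
    omega
  grind

end Walks

section Amalgams

variable {A B₁ B₂ C : Type u} {m : ℕ} {GA : SimpleGraph A} {G₁ : SimpleGraph B₁}
  {G₂ : SimpleGraph B₂} {GC : SimpleGraph C}

/-- The graph `GC` is the union of `G₁` and `G₂` glued exactly along `GA`. -/
structure IsFreeAmalgam (ι₁ : GA ↪g G₁) (ι₂ : GA ↪g G₂) (κ₁ : G₁ ↪g GC) (κ₂ : G₂ ↪g GC) :
    Prop where
  comm : ∀ a, κ₁ (ι₁ a) = κ₂ (ι₂ a)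
  cover : ∀ x, x ∈ Set.range κ₁ ∨ x ∈ Set.range κ₂
  inter : ∀ b b', κ₁ b = κ₂ b' → ∃ a, ι₁ a = b ∧ ι₂ a = b'
  adj : ∀ x y, GC.Adj x y → (∃ b b', G₁.Adj b b' ∧ κ₁ b = x ∧ κ₁ b' = y) ∨
    ∃ b b', G₂.Adj b b' ∧ κ₂ b = x ∧ κ₂ b' = y

/-- The graphs `G₁` and `G₂` embed strongly over `GA` into a finite graph without short cycles,
with a proper colouring extending `c₁`, which they cover. -/
def HasAmalgam (m : ℕ) (ι₁ : GA ↪g G₁) (ι₂ : GA ↪g G₂) (c₁ : B₁ → Bool) : Prop :=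
  ∃ (C : Type u) (_ : Finite C) (GC : SimpleGraph C) (κ₁ : G₁ ↪g GC) (κ₂ : G₂ ↪g GC)
    (c : C → Bool), (∀ ⦃x y⦄, GC.Adj x y → c x ≠ c y) ∧ (∀ b, c (κ₁ b) = c₁ b) ∧
    ((2 * m + 1 + 1 : ℕ) : ℕ∞) ≤ GC.egirth ∧ IsStrong m GC (Set.range κ₁) ∧
    IsStrong m GC (Set.range κ₂) ∧ (∀ a, κ₁ (ι₁ a) = κ₂ (ι₂ a)) ∧
    ∀ x, x ∈ Set.range κ₁ ∨ x ∈ Set.range κ₂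

lemma exists_isFreeAmalgam [Finite B₁] [Finite B₂] (ι₁ : GA ↪g G₁) (ι₂ : GA ↪g G₂) :
    ∃ (C : Type u) (_ : Finite C) (GC : SimpleGraph C) (κ₁ : G₁ ↪g GC) (κ₂ : G₂ ↪g GC),
      IsFreeAmalgam ι₁ ι₂ κ₁ κ₂ := by
  classical
  let k₂ : B₂ → B₂ ⊕ {b // b ∉ Set.range ι₁} := Sum.inl
  let k₁ : B₁ → B₂ ⊕ {b // b ∉ Set.range ι₁} := fun b =>
    if h : b ∈ Set.range ι₁ then .inl (ι₂ h.choose) else .inr ⟨b, h⟩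
  have hk₁ : ∀ a, k₁ (ι₁ a) = k₂ (ι₂ a) := fun a => by
    have h : ι₁ a ∈ Set.range ι₁ := ⟨a, rfl⟩
    have h' : h.choose = a := ι₁.injective h.choose_spec
    simp only [k₁, k₂, dif_pos h, h']
  have hk₁' : ∀ b (h : b ∉ Set.range ι₁), k₁ b = .inr ⟨b, h⟩ := fun b h => dif_neg h
  have hinter : ∀ b b', k₁ b = k₂ b' → ∃ a, ι₁ a = b ∧ ι₂ a = b' := fun b b' h => by
    by_cases hb : b ∈ Set.range ι₁
    · obtain ⟨a, rfl⟩ := hb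
      rw [hk₁] at h
      exact ⟨a, rfl, Sum.inl_injective h⟩
    · rw [hk₁' b hb] at h
      cases h
  have hinj₂ : Function.Injective k₂ := Sum.inl_injective
  have hinj₁ : Function.Injective k₁ := fun b b' h => by
    by_cases hb : b' ∈ Set.range ι₁
    · obtain ⟨a, rfl⟩ := hb
      rw [hk₁] at h
      obtain ⟨a', rfl, h'⟩ := hinter _ _ h
      rw [ι₂.injective h']
    · by_cases hb' : b ∈ Set.range ι₁
      · obtain ⟨a, rfl⟩ := hb'
        rw [hk₁] at h
        obtain ⟨a', rfl, h'⟩ := hinter _ _ h.symm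
        rw [ι₂.injective h']
      · rw [hk₁' _ hb, hk₁' _ hb'] at h
        exact congrArg Subtype.val (Sum.inr_injective h)
  let GC : SimpleGraph (B₂ ⊕ {b // b ∉ Set.range ι₁}) :=
    { Adj := fun x y => (∃ b b', G₁.Adj b b' ∧ k₁ b = x ∧ k₁ b' = y) ∨
        ∃ b b', G₂.Adj b b' ∧ k₂ b = x ∧ k₂ b' = y
      symm := ⟨by
        rintro x y (⟨b, b', h, hx, hy⟩ | ⟨b, b', h, hx, hy⟩)
        · exact Or.inl ⟨b', b, h.symm, hy, hx⟩
        · exact Or.inr ⟨b', b, h.symm, hy, hx⟩⟩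
      loopless := ⟨by
        rintro x (⟨b, b', h, rfl, hx⟩ | ⟨b, b', h, rfl, hx⟩)
        · exact h.ne (hinj₁ hx.symm)
        · exact h.ne (hinj₂ hx.symm)⟩ }
  refine ⟨_, inferInstance, GC,
    ⟨⟨k₁, hinj₁⟩, fun {b b'} => ⟨?_, fun h => Or.inl ⟨b, b', h, rfl, rfl⟩⟩⟩,
    ⟨⟨k₂, hinj₂⟩, fun {b b'} => ⟨?_, fun h => Or.inr ⟨b, b', h, rfl, rfl⟩⟩⟩,
    hk₁, ?_, hinter, fun x y h => h⟩
  · rintro (⟨x, y, h, hx, hy⟩ | ⟨x, y, h, hx, hy⟩)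
    · rwa [← hinj₁ hx, ← hinj₁ hy]
    · obtain ⟨a, rfl, rfl⟩ := hinter _ _ hx.symm
      obtain ⟨a', rfl, rfl⟩ := hinter _ _ hy.symm
      rwa [ι₂.map_adj_iff, ← ι₁.map_adj_iff] at h
  · rintro (⟨x, y, h, hx, hy⟩ | ⟨x, y, h, hx, hy⟩)
    · obtain ⟨a, rfl, rfl⟩ := hinter _ _ hx
      obtain ⟨a', rfl, rfl⟩ := hinter _ _ hy
      rwa [ι₁.map_adj_iff, ← ι₂.map_adj_iff] at h
    · rwa [← hinj₂ hx, ← hinj₂ hy]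
  · rintro (b | ⟨b, hb⟩)
    · exact Or.inr ⟨b, rfl⟩
    · exact Or.inl ⟨b, hk₁' b hb⟩

namespace IsFreeAmalgam

variable {ι₁ : GA ↪g G₁} {ι₂ : GA ↪g G₂} {κ₁ : G₁ ↪g GC} {κ₂ : G₂ ↪g GC}

lemma symm (h : IsFreeAmalgam ι₁ ι₂ κ₁ κ₂) : IsFreeAmalgam ι₂ ι₁ κ₂ κ₁ where
  comm a := (h.comm a).symm
  cover x := (h.cover x).symm
  inter b b' hb := by
    obtain ⟨a, h₁, h₂⟩ := h.inter b' b hb.symm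
    exact ⟨a, h₂, h₁⟩
  adj x y hxy := (h.adj x y hxy).symm

lemma exists_glue (h : IsFreeAmalgam ι₁ ι₂ κ₁ κ₂) {X : Type*} [Inhabited X] (f₁ : B₁ → X)
    (f₂ : B₂ → X) : ∃ f : C → X, (∀ b, f (κ₂ b) = f₂ b) ∧
      ∀ b, b ∉ Set.range ι₁ → f (κ₁ b) = f₁ b := by
  refine ⟨Function.extend κ₂ f₂ (Function.extend κ₁ f₁ default),
    fun b => κ₂.injective.extend_apply _ _ _, fun b hb => ?_⟩
  rw [Function.extend_apply', κ₁.injective.extend_apply]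
  rintro ⟨b', hb'⟩
  obtain ⟨a, rfl, -⟩ := h.inter b b' hb'.symm
  exact hb ⟨a, rfl⟩

lemma isStrong_right (h : IsFreeAmalgam ι₁ ι₂ κ₁ κ₂) (hs : IsStrong m G₁ (Set.range ι₁)) :
    IsStrong m GC (Set.range κ₂) := by
  intro D hD hne
  have hDκ : κ₁ '' (κ₁ ⁻¹' D) = D := Set.image_preimage_eq_of_subset fun x hx =>
    (h.cover x).resolve_right (Set.disjoint_left.1 hD hx)
  have hr := (hs (κ₁ ⁻¹' D) ?_ ?_).map κ₁
  · rw [hDκ] at hr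
    refine hr.extend ?_ fun v hv w hw ha => ?_
    · rw [Set.image_union, hDκ]
      refine Set.union_subset_union_left _ ?_
      rintro _ ⟨_, ⟨a, rfl⟩, rfl⟩
      exact ⟨ι₂ a, (h.comm a).symm⟩
    · rcases h.adj v w ha with ⟨b, b', -, rfl, rfl⟩ | ⟨b, b', -, rfl, rfl⟩
      · refine ⟨b', ?_, rfl⟩
        rcases hw with ⟨x, hx⟩ | hw
        · obtain ⟨a, rfl, -⟩ := h.inter b' x hx.symm
          exact Or.inl ⟨a, rfl⟩
        · exact Or.inr hw
      · exact absurd ⟨b, rfl⟩ (Set.disjoint_left.1 hD hv)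
  · refine Set.disjoint_left.2 fun x hx hxr => ?_
    obtain ⟨a, rfl⟩ := hxr
    exact Set.disjoint_left.1 hD hx ⟨ι₂ a, (h.comm a).symm⟩
  · rw [← hDκ] at hne
    exact hne.of_image

lemma hasAmalgam [Finite C] (h : IsFreeAmalgam ι₁ ι₂ κ₁ κ₂) {c₁ : B₁ → Bool} {c₂ : B₂ → Bool}
    (hc₁ : ∀ ⦃x y⦄, G₁.Adj x y → c₁ x ≠ c₁ y) (hc₂ : ∀ ⦃x y⦄, G₂.Adj x y → c₂ x ≠ c₂ y)
    (hc : ∀ a, c₁ (ι₁ a) = c₂ (ι₂ a)) (hs₁ : IsStrong m G₁ (Set.range ι₁))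
    (hs₂ : IsStrong m G₂ (Set.range ι₂)) (hg : ((2 * m + 1 + 1 : ℕ) : ℕ∞) ≤ GC.egirth) :
    HasAmalgam m ι₁ ι₂ c₁ := by
  obtain ⟨c, h₂, h₁⟩ := h.exists_glue c₁ c₂
  replace h₁ : ∀ b, c (κ₁ b) = c₁ b := fun b => by
    by_cases hb : b ∈ Set.range ι₁
    · obtain ⟨a, rfl⟩ := hb
      rw [h.comm, h₂, hc]
    · exact h₁ b hb
  refine ⟨C, ‹_›, GC, κ₁, κ₂, c, fun x y hxy => ?_, h₁, hg, h.symm.isStrong_right hs₂,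
    h.isStrong_right hs₁, h.comm, h.cover⟩
  rcases h.adj x y hxy with ⟨b, b', hb, rfl, rfl⟩ | ⟨b, b', hb, rfl, rfl⟩
  · rw [h₁, h₁]
    exact hc₁ hb
  · rw [h₂, h₂]
    exact hc₂ hb

end IsFreeAmalgam

end Amalgams

section OneStep

variable {A B₁ B₂ C : Type u} {m : ℕ} {GA : SimpleGraph A} {G₁ : SimpleGraph B₁}
  {G₂ : SimpleGraph B₂} {GC : SimpleGraph C} {ι₁ : GA ↪g G₁} {ι₂ : GA ↪g G₂} {g : ℕ → B₁}

lemma IsFreeAmalgam.le_egirth_of_isLoose {κ₁ : G₁ ↪g GC} {κ₂ : G₂ ↪g GC}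
    (h : IsFreeAmalgam ι₁ ι₂ κ₁ κ₂) {K : ℕ} (hg₂ : ((K + 1 : ℕ) : ℕ∞) ≤ G₂.egirth) {v : B₁}
    (hv : IsLoose G₁ Set.univ v) (hcov : ∀ b, b ∈ Set.range ι₁ ∨ b = v) :
    ((K + 1 : ℕ) : ℕ∞) ≤ GC.egirth := by
  have hκ : ∀ x, x ∉ Set.range κ₂ → x = κ₁ v := fun x hx => by
    obtain ⟨b, rfl⟩ := (h.cover x).resolve_right hx
    rcases hcov b with ⟨a, rfl⟩ | rfl
    · exact absurd ⟨_, (h.comm a).symm⟩ hx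
    · rfl
  refine le_egirth_of_potential κ₂ hg₂ fun u w huw hu => ?_
  obtain rfl := hκ u hu
  have hvι : v ∉ Set.range ι₁ := by
    rintro ⟨a, rfl⟩
    exact hu ⟨_, (h.comm a).symm⟩
  have huniq : ∀ x, GC.Adj (κ₁ v) x → x = w := fun x hx => by
    have hlift : ∀ y, GC.Adj (κ₁ v) y → ∃ b, G₁.Adj v b ∧ κ₁ b = y := fun y hy => by
      rcases h.adj _ _ hy with ⟨b, b', hb, he, rfl⟩ | ⟨b, b', hb, he, rfl⟩
      · exact ⟨b', κ₁.injective he ▸ hb, rfl⟩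
      · exact absurd ⟨b, he⟩ hu
    obtain ⟨b, hb, rfl⟩ := hlift x hx
    obtain ⟨b', hb', rfl⟩ := hlift w huw
    rw [hv b trivial b' trivial hb hb']
  have hw : w ∈ Set.range κ₂ := by
    by_contra hw
    exact huw.ne (hκ w hw).symm
  obtain ⟨φ, hφ₂, hφ₁⟩ := h.exists_glue (fun _ => (K : ℤ)) fun _ => 0
  refine ⟨φ, ?_, fun a b hab hne => ?_⟩
  · obtain ⟨b, rfl⟩ := hw
    simp [hφ₂, hφ₁ v hvι]
  · by_cases ha : a ∈ Set.range κ₂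
    · by_cases hb : b ∈ Set.range κ₂
      · obtain ⟨a, rfl⟩ := ha
        obtain ⟨b, rfl⟩ := hb
        simp [hφ₂]
      · obtain rfl := hκ b hb
        exact absurd (by rw [huniq a hab.symm, Sym2.eq_swap]) hne
    · obtain rfl := hκ a ha
      exact absurd (by rw [huniq b hab]) hne

lemma hasAmalgam_of_isLoose [Finite B₁] [Finite B₂] {c₁ : B₁ → Bool} {c₂ : B₂ → Bool}
    (hc₁ : ∀ ⦃x y⦄, G₁.Adj x y → c₁ x ≠ c₁ y) (hc₂ : ∀ ⦃x y⦄, G₂.Adj x y → c₂ x ≠ c₂ y)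
    (hc : ∀ a, c₁ (ι₁ a) = c₂ (ι₂ a)) (hs₂ : IsStrong m G₂ (Set.range ι₂))
    (hg₂ : ((2 * m + 1 + 1 : ℕ) : ℕ∞) ≤ G₂.egirth) {v : B₁} (hv : IsLoose G₁ Set.univ v)
    (hcov : ∀ b, b ∈ Set.range ι₁ ∨ b = v) : HasAmalgam m ι₁ ι₂ c₁ := by
  obtain ⟨C, _, GC, κ₁, κ₂, h⟩ := exists_isFreeAmalgam ι₁ ι₂
  refine h.hasAmalgam hc₁ hc₂ hc (fun D hD ⟨x, hx⟩ => ?_) hs₂ (h.le_egirth_of_isLoose hg₂ hv hcov)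
  obtain rfl := (hcov x).resolve_left (Set.disjoint_left.1 hD hx)
  exact Or.inl ⟨x, hx, hv.mono (Set.subset_univ _)⟩

lemma IsFreeAmalgam.le_egirth_of_isArc {κ₁ : G₁ ↪g GC} {κ₂ : G₂ ↪g GC}
    (h : IsFreeAmalgam ι₁ ι₂ κ₁ κ₂) (hm : 2 ≤ m)
    (hg₂ : ((2 * m + 1 + 1 : ℕ) : ℕ∞) ≤ G₂.egirth)
    (hg : IsArc m G₁ Set.univ (Set.range ι₁)ᶜ g)
    (hcov : ∀ b, b ∈ Set.range ι₁ ∨ ∃ i, 0 < i ∧ i < m ∧ b = g i) {a₀ a₁ : A}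
    (h₀ : g 0 = ι₁ a₀) (h₁ : g m = ι₁ a₁)
    (hd : ∀ p : G₂.Walk (ι₂ a₀) (ι₂ a₁), m + 2 ≤ p.length) :
    ((2 * m + 1 + 1 : ℕ) : ℕ∞) ≤ GC.egirth := by
  obtain ⟨d, hd₀, hd₁, hd⟩ := exists_distance_potential hd
  have hidx : ∀ k ≤ m, Function.invFunOn g (Set.Iic m) (g k) = k := fun k hk =>
    hg.2.1.leftInvOn_invFunOn hk
  have hedge₁ : ∀ b b', G₁.Adj b b' → b ∉ Set.range ι₁ →
      ∃ j < m, s(κ₁ b, κ₁ b') = s(κ₁ (g j), κ₁ (g (j + 1))) := fun b b' hbb hb => by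
    obtain ⟨i, hi0, him, rfl⟩ := (hcov b).resolve_left hb
    rcases hg.eq_or_eq hi0 him trivial hbb with rfl | rfl
    · exact ⟨i - 1, by omega, by rw [Nat.sub_add_cancel hi0, Sym2.eq_swap]⟩
    · exact ⟨i, him, rfl⟩
  have hedge : ∀ x y, GC.Adj x y → (∃ b b', G₂.Adj b b' ∧ κ₂ b = x ∧ κ₂ b' = y) ∨
      ∃ j < m, s(x, y) = s(κ₁ (g j), κ₁ (g (j + 1))) := fun x y hxy => by
    rcases h.adj x y hxy with ⟨b, b', hb, rfl, rfl⟩ | hb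
    · by_cases hbr : b ∈ Set.range ι₁
      · by_cases hbr' : b' ∈ Set.range ι₁
        · obtain ⟨a, rfl⟩ := hbr
          obtain ⟨a', rfl⟩ := hbr'
          rw [ι₁.map_adj_iff, ← ι₂.map_adj_iff] at hb
          exact Or.inl ⟨_, _, hb, (h.comm a).symm, (h.comm a').symm⟩
        · rw [Sym2.eq_swap]
          exact Or.inr (hedge₁ b' b hb.symm hbr')
      · exact Or.inr (hedge₁ b b' hb hbr)
    · exact Or.inl hb
  refine le_egirth_of_potential κ₂ hg₂ fun u w huw hu => ?_
  obtain ⟨b, b', -, hb, -⟩ | ⟨j, hj, hjuw⟩ := hedge u w huw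
  · exact absurd ⟨b, hb⟩ hu
  obtain ⟨φ, hφ₂, hφ₁⟩ := h.exists_glue
    (fun b => let k := Function.invFunOn g (Set.Iic m) b
      if k ≤ j then (j - k : ℤ) else j + 2 * m + 2 - k) fun b => j + d b
  have hφg : ∀ k ≤ m, φ (κ₁ (g k)) = if k ≤ j then (j - k : ℤ) else j + 2 * m + 2 - k := by
    intro k hk
    rcases Nat.eq_zero_or_pos k with rfl | hk0
    · rw [h₀, h.comm, hφ₂, hd₀]
      simp
    · rcases hk.eq_or_lt with rfl | hkm
      · rw [h₁, h.comm, hφ₂, hd₁, if_neg (by omega)]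
        push_cast
        ring
      · rw [hφ₁ _ (hg.mem_right hk0 hkm)]
        simp only [hidx k hk]
  refine ⟨φ, ?_, fun x y hxy hne => ?_⟩
  · have hK : (2 * m + 1 : ℤ) ≤ |φ (κ₁ (g j)) - φ (κ₁ (g (j + 1)))| := by
      rw [hφg j hj.le, hφg (j + 1) hj, if_pos le_rfl, if_neg (by omega), le_abs]
      push_cast
      omega
    push_cast
    rcases Sym2.eq_iff.1 hjuw with ⟨rfl, rfl⟩ | ⟨rfl, rfl⟩
    · exact hK
    · rwa [abs_sub_comm]
  · rcases hedge x y hxy with ⟨b, b', hb, rfl, rfl⟩ | ⟨i, hi, hixy⟩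
    · rw [hφ₂, hφ₂, add_sub_add_left_eq_sub]
      exact hd _ _ hb
    · have hij : i ≠ j := by
        rintro rfl
        exact hne (hixy.trans hjuw.symm)
      have hK : |φ (κ₁ (g i)) - φ (κ₁ (g (i + 1)))| ≤ 1 := by
        rw [hφg i hi.le, hφg (i + 1) hi, abs_le]
        split_ifs <;> push_cast <;> omega
      rcases Sym2.eq_iff.1 hixy with ⟨rfl, rfl⟩ | ⟨rfl, rfl⟩
      · exact hK
      · rwa [abs_sub_comm]

lemma IsArc.lt_length (hm : 2 ≤ m) (hg₁ : ((2 * m + 1 + 1 : ℕ) : ℕ∞) ≤ G₁.egirth)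
    (hg : IsArc m G₁ Set.univ (Set.range ι₁)ᶜ g) {a₀ a₁ : A} (h₀ : g 0 = ι₁ a₀)
    (h₁ : g m = ι₁ a₁) (q : GA.Walk a₀ a₁) : m < q.length := by
  by_contra! hq
  obtain ⟨k, rfl⟩ : ∃ k, m = k + 1 := ⟨m - 1, by omega⟩
  obtain ⟨p, hp, -, hpe⟩ := exists_walk_getVert_eq k (fun i => g (i + 1))
    fun i hi => hg.1 (i + 1) (by omega)
  have hg1 : g 1 ∉ Set.range ι₁ := hg.mem_right one_pos (by omega)
  have := le_length_add_one_of_le_egirth hg₁ (hg.1 0 (by omega))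
    (p.append ((q.reverse.map ι₁.toHom).copy h₁.symm h₀.symm)) ?_
  · rw [Walk.length_append, Walk.length_copy, Walk.length_map, Walk.length_reverse, hp] at this
    have := Nat.cast_le.1 this
    omega
  · rw [Walk.edges_append, List.mem_append, not_or, Walk.edges_copy, Walk.edges_map]
    constructor
    · intro he
      obtain ⟨i, hi, he⟩ := hpe _ he
      rcases Sym2.eq_iff.1 he with ⟨h, -⟩ | ⟨h, -⟩
      · have := hg.eq_of_eq (by omega) (by omega) h
        omega
      · have := hg.eq_of_eq (by omega) (by omega) h
        omega
    · intro he
      obtain ⟨e, -, he⟩ := List.mem_map.1 he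
      have : g 1 ∈ e.map ι₁ := he ▸ Sym2.mem_mk_right _ _
      obtain ⟨a, -, ha⟩ := Sym2.mem_map.1 this
      exact hg1 ⟨a, ha⟩

lemma hasAmalgam_of_arcs [Finite B₂] (hm : 2 ≤ m) {c₁ : B₁ → Bool} {c₂ : B₂ → Bool}
    (hc₁ : ∀ ⦃x y⦄, G₁.Adj x y → c₁ x ≠ c₁ y) (hc₂ : ∀ ⦃x y⦄, G₂.Adj x y → c₂ x ≠ c₂ y)
    (hc : ∀ a, c₁ (ι₁ a) = c₂ (ι₂ a)) (hs₂ : IsStrong m G₂ (Set.range ι₂))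
    (hg₂ : ((2 * m + 1 + 1 : ℕ) : ℕ∞) ≤ G₂.egirth)
    (hg : IsArc m G₁ Set.univ (Set.range ι₁)ᶜ g)
    (hcov : ∀ b, b ∈ Set.range ι₁ ∨ ∃ i, 0 < i ∧ i < m ∧ b = g i) {a₀ a₁ : A}
    (h₀ : g 0 = ι₁ a₀) (h₁ : g m = ι₁ a₁) {h : ℕ → B₂} {D : Set B₂} (hh₀ : h 0 = ι₂ a₀)
    (hh₁ : h m = ι₂ a₁) (hD : Disjoint D (Set.range ι₂))
    (hDh : ∀ v ∈ D, ∃ i, 0 < i ∧ i < m ∧ v = h i)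
    (hh : IsArc m G₂ (Set.range ι₂ ∪ D) D h) : HasAmalgam m ι₁ ι₂ c₁ := by
  classical
  let k : B₁ → B₂ := fun b =>
    if hb : b ∈ Set.range ι₁ then ι₂ hb.choose else h (Function.invFunOn g (Set.Iic m) b)
  have hkι : ∀ a, k (ι₁ a) = ι₂ a := fun a => by
    have hb : ι₁ a ∈ Set.range ι₁ := ⟨a, rfl⟩
    simp only [k, dif_pos hb, ι₁.injective hb.choose_spec]
  have hkg : ∀ i ≤ m, k (g i) = h i := fun i hi => by
    rcases Nat.eq_zero_or_pos i with rfl | hi0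
    · rw [h₀, hkι, hh₀]
    rcases hi.eq_or_lt with rfl | him
    · rw [h₁, hkι, hh₁]
    simp only [k, dif_neg (hg.mem_right hi0 him : g i ∉ Set.range ι₁)]
    rw [hg.2.1.leftInvOn_invFunOn hi]
  have hkh : ∀ b, ∀ j ≤ m, k b = h j → b = g j := fun b j hj hb => by
    rcases hcov b with ⟨a, rfl⟩ | ⟨i, hi0, him, rfl⟩
    · rw [hkι] at hb
      rcases Nat.eq_zero_or_pos j with rfl | hj0
      · rw [h₀, ι₂.injective (hb.trans hh₀)]
      rcases hj.eq_or_lt with rfl | hjm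
      · rw [h₁, ι₂.injective (hb.trans hh₁)]
      exact absurd ⟨a, hb⟩ (Set.disjoint_left.1 hD (hh.mem_right hj0 hjm))
    · rw [hkg i him.le] at hb
      rw [hh.eq_of_eq him.le hj hb]
  have hkS : ∀ b, k b ∈ Set.range ι₂ ∪ D := fun b => by
    rcases hcov b with ⟨a, rfl⟩ | ⟨i, hi0, him, rfl⟩
    · exact Or.inl ⟨a, (hkι a).symm⟩
    · rw [hkg i him.le]
      exact Or.inr (hh.mem_right hi0 him)
  have hinj : Function.Injective k := fun b b' hb => by
    rcases hcov b with ⟨a, rfl⟩ | ⟨i, hi0, him, rfl⟩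
    · rcases hcov b' with ⟨a', rfl⟩ | ⟨i, hi0, him, rfl⟩
      · rw [hkι, hkι] at hb
        rw [ι₂.injective hb]
      · exact hkh _ i him.le (hb.trans (hkg i him.le))
    · exact (hkh _ i him.le (hb.symm.trans (hkg i him.le))).symm
  have hadj : ∀ i, 0 < i → i < m → ∀ b, G₂.Adj (k (g i)) (k b) ↔ G₁.Adj (g i) b := by
    intro i hi0 him b
    rw [hkg i him.le]
    constructor
    · intro hb
      rcases hh.eq_or_eq hi0 him (hkS b) hb with hb | hb
      · rw [hkh b _ (by omega) hb]
        exact hg.adj_pred hi0 him.le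
      · rw [hkh b _ (by omega) hb]
        exact hg.1 i him
    · intro hb
      rcases hg.eq_or_eq hi0 him trivial hb with rfl | rfl
      · rw [hkg _ (by omega)]
        exact hh.adj_pred hi0 him.le
      · rw [hkg _ (by omega)]
        exact hh.1 i him
  have hmap : ∀ b b', G₂.Adj (k b) (k b') ↔ G₁.Adj b b' := fun b b' => by
    rcases hcov b with ⟨a, rfl⟩ | ⟨i, hi0, him, rfl⟩
    · rcases hcov b' with ⟨a', rfl⟩ | ⟨i, hi0, him, rfl⟩
      · rw [hkι, hkι, ι₁.map_adj_iff, ι₂.map_adj_iff]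
      · rw [G₂.adj_comm, G₁.adj_comm, hadj i hi0 him]
    · exact hadj i hi0 him b'
  have hrange : Set.range k = Set.range ι₂ ∪ D := by
    refine (Set.range_subset_iff.2 hkS).antisymm (Set.union_subset ?_ fun v hv => ?_)
    · rintro _ ⟨a, rfl⟩
      exact ⟨_, hkι a⟩
    · obtain ⟨i, -, him, rfl⟩ := hDh v hv
      exact ⟨_, hkg i him.le⟩
  have hcg : ∀ i ≤ m, c₂ (h i) = c₁ (g i) := fun i hi => by
    induction i with
    | zero => rw [hh₀, h₀, hc]
    | succ i ih =>
      have e := ih (by omega)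
      have e₁ := hc₁ (hg.1 i hi)
      have e₂ := hc₂ (hh.1 i hi)
      cases h1 : c₁ (g i) <;> cases h2 : c₁ (g (i + 1)) <;> cases h3 : c₂ (h (i + 1)) <;> simp_all
  refine ⟨B₂, ‹_›, G₂, ⟨⟨k, hinj⟩, fun {b b'} => hmap b b'⟩, Embedding.refl, c₂, hc₂,
    fun b => ?_, hg₂, ?_, fun D' hD' ⟨x, hx⟩ => ?_, hkι, fun x => Or.inr ⟨x, rfl⟩⟩
  · change c₂ (k b) = c₁ b
    rcases hcov b with ⟨a, rfl⟩ | ⟨i, -, him, rfl⟩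
    · rw [hkι, hc]
    · rw [hkg i him.le, hcg i him.le]
  · change IsStrong m G₂ (Set.range k)
    rw [hrange]
    exact hs₂.union_arc hm hDh hh hD
  · exact absurd ⟨x, rfl⟩ (Set.disjoint_left.1 hD' hx)

lemma hasAmalgam_of_isArc [Finite B₁] [Finite B₂] (hm : 2 ≤ m) {c₁ : B₁ → Bool}
    {c₂ : B₂ → Bool} (hc₁ : ∀ ⦃x y⦄, G₁.Adj x y → c₁ x ≠ c₁ y)
    (hc₂ : ∀ ⦃x y⦄, G₂.Adj x y → c₂ x ≠ c₂ y) (hc : ∀ a, c₁ (ι₁ a) = c₂ (ι₂ a))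
    (hs₂ : IsStrong m G₂ (Set.range ι₂)) (hg₁ : ((2 * m + 1 + 1 : ℕ) : ℕ∞) ≤ G₁.egirth)
    (hg₂ : ((2 * m + 1 + 1 : ℕ) : ℕ∞) ≤ G₂.egirth)
    (hg : IsArc m G₁ Set.univ (Set.range ι₁)ᶜ g)
    (hcov : ∀ b, b ∈ Set.range ι₁ ∨ ∃ i, 0 < i ∧ i < m ∧ b = g i) {a₀ a₁ : A}
    (h₀ : g 0 = ι₁ a₀) (h₁ : g m = ι₁ a₁) : HasAmalgam m ι₁ ι₂ c₁ := by
  by_cases hd : ∀ p : G₂.Walk (ι₂ a₀) (ι₂ a₁), m + 2 ≤ p.length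
  · obtain ⟨C, _, GC, κ₁, κ₂, h⟩ := exists_isFreeAmalgam ι₁ ι₂
    refine h.hasAmalgam hc₁ hc₂ hc (fun D hD ⟨x, hx⟩ => ?_) hs₂
      (h.le_egirth_of_isArc hm hg₂ hg hcov h₀ h₁ hd)
    obtain ⟨i, hi0, him, rfl⟩ := (hcov x).resolve_left (Set.disjoint_left.1 hD hx)
    refine (hg.reducible_of_subset (S' := Set.range ι₁ ∪ D) (Set.subset_univ _) hi0 him
      (Or.inr hx)).mono_right ?_
    rintro y ⟨hy, hy' | hy'⟩
    · exact absurd hy' hy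
    · exact hy'
  · push Not at hd
    obtain ⟨p, hp⟩ := hd
    obtain ⟨r, hr, -⟩ := exists_walk_getVert_eq m g hg.1
    have hpar : Even p.length ↔ Even m := by
      rw [even_length_iff hc₂ p, ← hc, ← hc, ← h₀, ← h₁, ← even_length_iff hc₁ r, hr]
    have hpm : p.length ≤ m := by
      by_contra! hlt
      rw [show p.length = m + 1 by omega, Nat.even_add_one] at hpar
      tauto
    rcases hs₂.exists_walk_or_arc hm ι₂ _ a₀ a₁ p rfl hpm with
      ⟨q, hq⟩ | ⟨-, h, D, hh₀, hh₁, hD, hDh, hh⟩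
    · have := hg.lt_length hm hg₁ h₀ h₁ q
      omega
    · exact hasAmalgam_of_arcs hm hc₁ hc₂ hc hs₂ hg₂ hg hcov h₀ h₁ hh₀ hh₁ hD hDh hh

end OneStep

section Induction

variable {A A' B₁ B₂ : Type u} {m : ℕ} {GA : SimpleGraph A} {G' : SimpleGraph A'}
  {G₁ : SimpleGraph B₁} {G₂ : SimpleGraph B₂}

lemma HasAmalgam.trans (hm : 2 ≤ m) {ι₁ : GA ↪g G₁} {ι₂ : GA ↪g G₂} {ι : GA ↪g G'}
    {j : G' ↪g G₁} {c₁ : B₁ → Bool} (hι : ∀ a, j (ι a) = ι₁ a)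
    (h : HasAmalgam m ι ι₂ (c₁ ∘ j))
    (step : ∀ (C : Type u) (_ : Finite C) (GC : SimpleGraph C) (κ : G' ↪g GC) (c : C → Bool),
      (∀ ⦃x y⦄, GC.Adj x y → c x ≠ c y) → (∀ b, c₁ (j b) = c (κ b)) →
      IsStrong m GC (Set.range κ) → ((2 * m + 1 + 1 : ℕ) : ℕ∞) ≤ GC.egirth →
      HasAmalgam m j κ c₁) : HasAmalgam m ι₁ ι₂ c₁ := by
  obtain ⟨C, hC, GC, κ₁, κ₂, c, hc, hc₁, hg, hs₁, hs₂, hcomm, hcov⟩ := h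
  obtain ⟨E, hE, GE, l₁, l₂, e, he, he₁, hge, ht₁, ht₂, hcomm', hcov'⟩ :=
    step C hC GC κ₁ c hc (fun b => (hc₁ b).symm) hs₁ hg
  refine ⟨E, hE, GE, l₁, l₂.comp κ₂, e, he, he₁, hge, ht₁, ?_, fun a => ?_, fun x => ?_⟩
  · have := hs₂.trans hm l₂ ht₂
    rwa [← Set.range_comp] at this
  · rw [← hι, hcomm', hcomm]
    rfl
  · rcases hcov' x with hx | ⟨y, rfl⟩
    · exact Or.inl hx
    · rcases hcov y with ⟨b, rfl⟩ | ⟨b, rfl⟩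
      · exact Or.inl ⟨j b, hcomm' b⟩
      · exact Or.inr ⟨b, rfl⟩

lemma hasAmalgam_of_isStrong [Finite B₂] (hm : 2 ≤ m) {ι₂ : GA ↪g G₂} {c₂ : B₂ → Bool}
    (hc₂ : ∀ ⦃x y⦄, G₂.Adj x y → c₂ x ≠ c₂ y) (hs₂ : IsStrong m G₂ (Set.range ι₂))
    (hg₂ : ((2 * m + 1 + 1 : ℕ) : ℕ∞) ≤ G₂.egirth) :
    ∀ (k : ℕ) {B₁ : Type u} [Finite B₁] {G₁ : SimpleGraph B₁} {ι₁ : GA ↪g G₁} {c₁ : B₁ → Bool},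
      (Set.range ι₁)ᶜ.ncard = k → (∀ ⦃x y⦄, G₁.Adj x y → c₁ x ≠ c₁ y) →
      (∀ a, c₁ (ι₁ a) = c₂ (ι₂ a)) → IsStrong m G₁ (Set.range ι₁) →
      ((2 * m + 1 + 1 : ℕ) : ℕ∞) ≤ G₁.egirth → HasAmalgam m ι₁ ι₂ c₁ := by
  intro k
  induction k using Nat.strong_induction_on with
  | h k ih =>
  intro B₁ _ G₁ ι₁ c₁ hk hc₁ hc hs₁ hg₁
  have key : ∀ P : Set B₁, P ⊆ (Set.range ι₁)ᶜ → P.Nonempty →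
      (∀ (C : Type u) (_ : Finite C) (GC : SimpleGraph C) (κ : G₁.induce Pᶜ ↪g GC)
        (c : C → Bool), (∀ ⦃x y⦄, GC.Adj x y → c x ≠ c y) →
        (∀ b : ↥Pᶜ, c₁ b = c (κ b)) → IsStrong m GC (Set.range κ) →
        ((2 * m + 1 + 1 : ℕ) : ℕ∞) ≤ GC.egirth → HasAmalgam m (Embedding.induce Pᶜ) κ c₁) →
      HasAmalgam m ι₁ ι₂ c₁ := by
    intro P hP hne step
    let ι : GA ↪g G₁.induce Pᶜ := ⟨⟨fun a => ⟨ι₁ a, fun h => hP h ⟨a, rfl⟩⟩,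
      fun a b hab => ι₁.injective (congrArg Subtype.val hab)⟩, ι₁.map_adj_iff⟩
    let j : G₁.induce Pᶜ ↪g G₁ := Embedding.induce Pᶜ
    have hrange : j '' Set.range ι = Set.range ι₁ := by
      rw [← Set.range_comp]
      rfl
    refine HasAmalgam.trans hm (ι := ι) (j := j) (fun _ => rfl) (ih _ ?_ rfl ?_ ?_ ?_ ?_) step
    · rw [← hk, ← Set.ncard_image_of_injective _ j.injective]
      refine Set.ncard_lt_ncard ((Set.ssubset_iff_of_subset ?_).2 ?_)
      · rintro _ ⟨x, hx, rfl⟩ ⟨a, ha⟩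
        exact hx ⟨a, j.injective ha⟩
      · obtain ⟨v, hv⟩ := hne
        refine ⟨v, hP hv, ?_⟩
        rintro ⟨x, -, rfl⟩
        exact x.2 hv
    · exact fun x y hxy => hc₁ hxy
    · exact hc
    · exact IsStrong.of_map j (hrange ▸ hs₁)
    · exact hg₁.trans (IsContained.egirth_le ⟨j.toCopy⟩)
  have hj : ∀ P : Set B₁, Set.range (Embedding.induce (G := G₁) Pᶜ) = Pᶜ := fun P =>
    Subtype.range_coe
  rcases Set.eq_empty_or_nonempty (Set.range ι₁)ᶜ with hD | hD
  · rw [Set.compl_empty_iff] at hD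
    let e := RelIso.ofSurjective ι₁ (Set.range_eq_univ.1 hD)
    have he : ∀ a, e.symm (ι₁ a) = a := e.symm_apply_apply
    have hrange : Set.range (ι₂.comp e.symm.toRelEmbedding) = Set.range ι₂ :=
      e.symm.surjective.range_comp ι₂
    refine ⟨B₂, ‹_›, G₂, ι₂.comp e.symm.toRelEmbedding, Embedding.refl, c₂, hc₂, fun b => ?_, hg₂,
      hrange ▸ hs₂, fun D' hD' ⟨x, hx⟩ => ?_, fun a => congrArg ι₂ (he a),
      fun x => Or.inr ⟨x, rfl⟩⟩
    · obtain ⟨a, rfl⟩ := Set.range_eq_univ.1 hD b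
      exact (congrArg (fun a => c₂ (ι₂ a)) (he a)).trans (hc a).symm
    · exact absurd ⟨x, rfl⟩ (Set.disjoint_left.1 hD' hx)
  have hr := hs₁ _ disjoint_compl_left hD
  rw [Set.union_compl_self] at hr
  rcases hr with ⟨v, hvD, hv⟩ | ⟨g, hg⟩
  · refine key {v} (by simpa using hvD) ⟨v, rfl⟩ fun C _ GC κ c hcC hcκ hs hgC =>
      hasAmalgam_of_isLoose hc₁ hcC hcκ hs hgC hv fun b => ?_
    rw [hj, or_comm]
    exact em _
  · set P : Set B₁ := {b | ∃ i, 0 < i ∧ i < m ∧ b = g i} with hPdef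
    have hmem : ∀ i ≤ m, ¬ (0 < i ∧ i < m) → g i ∈ Pᶜ := by
      rintro i hi hn ⟨i', h0, h1, he⟩
      obtain rfl := hg.eq_of_eq hi h1.le he
      exact hn ⟨h0, h1⟩
    refine key P ?_ ⟨g 1, 1, one_pos, hm, rfl⟩ fun C _ GC κ c hcC hcκ hs hgC =>
      hasAmalgam_of_isArc hm (g := g) (a₀ := ⟨g 0, hmem 0 (by omega) (by omega)⟩)
        (a₁ := ⟨g m, hmem m le_rfl (by omega)⟩) hc₁ hcC hcκ hs hg₁ hgC ?_ (fun b => ?_) rfl rfl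
    · rintro _ ⟨i, h0, hi, rfl⟩
      exact hg.mem_right h0 hi
    · rw [hj, compl_compl]
      exact ⟨hg.1, hg.2.1, hg.2.2.1, fun i h0 hi => ⟨⟨i, h0, hi, rfl⟩, (hg.2.2.2 i h0 hi).2⟩⟩
    · rw [hj, or_comm]
      exact em _

end Induction

end GenPolygon

/-- The class of finite connected open partial n-gons with strong
(≤ₒ) embeddings has the amalgamation property. -/
theorem amalgamation {n : ℕ} (hn : 3 ≤ n)
    {A B₁ B₂ : Type u} [Finite A] [Finite B₁] [Finite B₂]
    (GA : SimpleGraph A) (GB₁ : SimpleGraph B₁) (GB₂ : SimpleGraph B₂)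
    (hA : GenPolygon.IsPartialGon n GA ∧ GenPolygon.IsOpenGraph n GA)
    (hB₁ : GenPolygon.IsPartialGon n GB₁ ∧ GenPolygon.IsOpenGraph n GB₁)
    (hB₂ : GenPolygon.IsPartialGon n GB₂ ∧ GenPolygon.IsOpenGraph n GB₂)
    (ι₁ : GA ↪g GB₁) (ι₂ : GA ↪g GB₂)
    (hs₁ : GenPolygon.StrongleO n GB₁ (Set.range ι₁) Set.univ)
    (hs₂ : GenPolygon.StrongleO n GB₂ (Set.range ι₂) Set.univ) :
    ∃ (C : Type u) (_ : Finite C) (GC : SimpleGraph C),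
      (GenPolygon.IsPartialGon n GC ∧ GenPolygon.IsOpenGraph n GC) ∧
      ∃ (κ₁ : GB₁ ↪g GC) (κ₂ : GB₂ ↪g GC),
        GenPolygon.StrongleO n GC (Set.range κ₁) Set.univ ∧
        GenPolygon.StrongleO n GC (Set.range κ₂) Set.univ ∧
        ∀ a, κ₁ (ι₁ a) = κ₂ (ι₂ a) := by
  open GenPolygon in
  obtain ⟨⟨hcA, -, -⟩, -⟩ := hA
  obtain ⟨⟨hcon₁, ⟨c₁, hc₁⟩, hg₁⟩, ho₁⟩ := hB₁
  obtain ⟨⟨hcon₂, ⟨c₂, hc₂⟩, hg₂⟩, -⟩ := hB₂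
  have hm : 2 ≤ n - 1 := by omega
  have hn2 : (2 * n : ℕ∞) = ((2 * (n - 1) + 1 + 1 : ℕ) : ℕ∞) := by
    rw [show 2 * (n - 1) + 1 + 1 = 2 * n by omega]
    push_cast
    rfl
  rw [hn2] at hg₁ hg₂
  rw [strongleO_univ_iff hn] at hs₁ hs₂
  rw [isOpenGraph_iff hn] at ho₁
  obtain ⟨a₀⟩ := hcA.nonempty
  have hagree : ∀ a, c₁ (ι₁ a) = xor (xor (c₁ (ι₁ a₀)) (c₂ (ι₂ a₀))) (c₂ (ι₂ a)) := fun a => by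
    obtain ⟨p⟩ := hcA.preconnected a₀ a
    have h₁ := even_length_iff hc₁ (p.map ι₁.toHom)
    have h₂ := even_length_iff hc₂ (p.map ι₂.toHom)
    rw [Walk.length_map] at h₁ h₂
    have h : c₁ (ι₁ a₀) = c₁ (ι₁ a) ↔ c₂ (ι₂ a₀) = c₂ (ι₂ a) := h₁.symm.trans h₂
    revert h
    cases c₁ (ι₁ a₀) <;> cases c₁ (ι₁ a) <;> cases c₂ (ι₂ a₀) <;> cases c₂ (ι₂ a) <;> simp
  obtain ⟨C, hC, GC, κ₁, κ₂, c, hc, -, hg, ht₁, ht₂, hcomm, hcov⟩ :=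
    hasAmalgam_of_isStrong hm (c₂ := fun b => xor (xor (c₁ (ι₁ a₀)) (c₂ (ι₂ a₀))) (c₂ b))
      (fun x y hxy h => hc₂ hxy (by simpa using h)) hs₂ hg₂ _ rfl hc₁ hagree hs₁ hg₁
  have hreach : ∀ x, GC.Reachable (κ₁ (ι₁ a₀)) x := fun x => by
    rcases hcov x with ⟨b, rfl⟩ | ⟨b, rfl⟩
    · exact (hcon₁.preconnected (ι₁ a₀) b).map κ₁.toHom
    · rw [hcomm]
      exact (hcon₂.preconnected (ι₂ a₀) b).map κ₂.toHom
  refine ⟨C, hC, GC, ⟨⟨?_, ⟨c, hc⟩, hn2 ▸ hg⟩, ?_⟩, κ₁, κ₂, (strongleO_univ_iff hn).2 ht₁,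
    (strongleO_univ_iff hn).2 ht₂, hcomm⟩
  · exact { preconnected := fun x y => (hreach x).symm.trans (hreach y), nonempty := ⟨κ₁ (ι₁ a₀)⟩ }
  · rw [isOpenGraph_iff hn]
    simpa using ho₁.trans hm κ₁ ht₁
end

section
/- Every finite partial n-gon A ∈ K, where K is the class of finite open partial n-gons, that contains a 2k-cycle for some k > n satisfies δ_n(A) ≥ 2n+2. -/
open SimpleGraph

universe u

namespace GenPolygon

variable {V : Type u} {G : SimpleGraph V} {n : ℕ}

theorem two_mul_le_length_add_one (hg : (2 * n : ℕ∞) ≤ G.egirth) {u v : V} (h : G.Adj u v)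
    (w : G.Walk v u) (he : s(u, v) ∉ w.edges) : 2 * n ≤ w.length + 1 := by
  classical
  have hc : (Walk.cons h w.bypass).IsCycle :=
    (Walk.cons_isCycle_iff _ _).2 ⟨w.bypass_isPath, fun h' => he (w.edges_bypass_subset_edges h')⟩
  have h1 := le_egirth.1 hg _ _ hc
  have h2 := w.length_bypass_le_length
  rw [Walk.length_cons] at h1
  have h3 : 2 * n ≤ w.bypass.length + 1 := by exact_mod_cast h1
  omega

theorem two_mul_le_length_add_length (hg : (2 * n : ℕ∞) ≤ G.egirth) {a b : V} (p : G.Walk a b)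
    (hp : p.IsPath) (w : G.Walk a b) {e : Sym2 V} (he : e ∈ p.edges) (hw : e ∉ w.edges) :
    2 * n ≤ p.length + w.length := by
  induction p with
  | nil => simp at he
  | cons h p ih =>
    have hn := hp.isTrail.edges_nodup
    rw [Walk.edges_cons, List.nodup_cons] at hn
    rw [Walk.edges_cons, List.mem_cons] at he
    rw [Walk.length_cons]
    rcases he with rfl | he
    · have := two_mul_le_length_add_one hg h (p.append w.reverse) (by
        simp only [Walk.edges_append, Walk.edges_reverse, List.mem_append, List.mem_reverse]
        tauto)
      simp only [Walk.length_append, Walk.length_reverse] at this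
      omega
    · have := ih hp.of_cons (w := Walk.cons h.symm w) he (by
        rw [Walk.edges_cons, List.mem_cons, not_or]
        refine ⟨?_, hw⟩
        rintro rfl
        rw [Sym2.eq_swap] at he
        exact hn.1 he)
      rw [Walk.length_cons] at this
      omega

theorem two_mul_le_of_length_lt (hg : (2 * n : ℕ∞) ≤ G.egirth) {a b : V} (p : G.Walk a b)
    (hp : p.IsPath) (w : G.Walk a b) (h : w.length < p.length) :
    2 * n ≤ p.length + w.length := by
  classical
  have : ∃ e ∈ p.edges, e ∉ w.edges := by
    by_contra! hcon
    have h1 : p.edges.toFinset ⊆ w.edges.toFinset := fun e he => by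
      rw [List.mem_toFinset] at he ⊢
      exact hcon e he
    have h2 := Finset.card_le_card h1
    rw [List.toFinset_card_of_nodup hp.isTrail.edges_nodup] at h2
    have h3 := w.edges.toFinset_card_le
    rw [Walk.length_edges] at h2 h3
    omega
  obtain ⟨e, he, hw⟩ := this
  exact two_mul_le_length_add_length hg p hp w he hw

/-- The subgraph induced on `A` is connected (or empty). -/
def ConnIn (G : SimpleGraph V) (A : Set V) : Prop :=
  ∀ x ∈ A, ∀ y ∈ A, ∃ w : G.Walk x y, ∀ v ∈ w.support, v ∈ A

/-- `A` is the vertex set of a closed walk of length `2n`. -/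
def IsRound (n : ℕ) (G : SimpleGraph V) (A : Set V) : Prop :=
  ∃ (v : V) (c : G.Walk v v), c.length = 2 * n ∧ ∀ x, x ∈ A ↔ x ∈ c.support

/-- Any two vertices of `A` are joined by a walk in `A` of length at most `n`. -/
def DiamLE (n : ℕ) (G : SimpleGraph V) (A : Set V) : Prop :=
  ∀ x ∈ A, ∀ y ∈ A, ∃ w : G.Walk x y, (∀ v ∈ w.support, v ∈ A) ∧ w.length ≤ n

theorem IsRound.exists_rotation {A : Set V} (h : IsRound n G A) {x : V} (hx : x ∈ A) :
    ∃ c : G.Walk x x, c.length = 2 * n ∧ ∀ y, y ∈ A ↔ y ∈ c.support := by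
  classical
  obtain ⟨v, c, hl, hc⟩ := h
  refine ⟨c.rotate x ((hc x).1 hx), by simp [hl], fun y => ?_⟩
  rw [hc y, Walk.mem_support_rotate_iff]

/-- A vertex of a round set `A` splits a closed walk into two walks joining `x` and `y`. -/
theorem IsRound.exists_split {A : Set V} (h : IsRound n G A) {x y : V} (hx : x ∈ A)
    (hy : y ∈ A) :
    ∃ (p : G.Walk x y) (q : G.Walk y x), p.length + q.length = 2 * n ∧
      ∀ z, z ∈ A ↔ z ∈ p.support ∨ z ∈ q.support := by
  classical
  obtain ⟨c, hl, hc⟩ := h.exists_rotation hx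
  have hy' := (hc y).1 hy
  refine ⟨c.takeUntil y hy', c.dropUntil y hy', ?_, fun z => ?_⟩
  · rw [← hl, ← Walk.length_append, Walk.take_spec]
  · rw [hc z, ← Walk.mem_support_append_iff, Walk.take_spec]

theorem IsRound.diamLE {A : Set V} (h : IsRound n G A) : DiamLE n G A := by
  intro x hx y hy
  obtain ⟨p, q, hl, hA⟩ := h.exists_split hx hy
  rcases le_total p.length q.length with h1 | h1
  · exact ⟨p, fun v hv => (hA v).2 (Or.inl hv), by omega⟩
  · refine ⟨q.reverse, fun v hv => (hA v).2 (Or.inr (by simpa using hv)), ?_⟩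
    rw [Walk.length_reverse]; omega

/-- In a round set, each vertex has at most one vertex at distance `n`. -/
theorem IsRound.exists_antipode {A : Set V} (h : IsRound n G A) {x : V} (hx : x ∈ A) :
    ∃ a, ∀ y ∈ A, y ≠ a → ∃ w : G.Walk x y, (∀ v ∈ w.support, v ∈ A) ∧ w.length < n := by
  classical
  obtain ⟨c, hl, hc⟩ := h.exists_rotation hx
  refine ⟨c.getVert n, fun y hy hya => ?_⟩
  have hy' := (hc y).1 hy
  have hlen : (c.takeUntil y hy').length + (c.dropUntil y hy').length = 2 * n := by
    rw [← hl, ← Walk.length_append, Walk.take_spec]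
  rcases lt_trichotomy (c.takeUntil y hy').length n with h1 | h1 | h1
  · exact ⟨_, fun v hv => (hc v).2 (c.support_takeUntil_subset_support hy' hv), h1⟩
  · refine absurd ?_ hya
    rw [← h1, Walk.getVert_length_takeUntil]
  · refine ⟨(c.dropUntil y hy').reverse, fun v hv => (hc v).2
      (c.support_dropUntil_subset_support hy' (by simpa using hv)), ?_⟩
    rw [Walk.length_reverse]; omega

theorem delta_diff_singleton [Finite V] (hn : 2 ≤ n) (A : Set V) {v : V} (hv : v ∈ A) :
    delta n G (A \ {v}) + ((n : ℤ) - 1) - ((n : ℤ) - 2) * degIn G A v ≤ delta n G A := by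
  have h1 : (A \ {v}).ncard + 1 = A.ncard := Set.ncard_sdiff_singleton_add_one hv
  have h2 : edgesIn G A ⊆ edgesIn G (A \ {v}) ∪ (fun u => s(v, u)) '' (G.neighborSet v ∩ A) := by
    rintro e ⟨he, hA⟩
    by_cases hve : v ∈ e
    · right
      obtain ⟨u, rfl⟩ := Sym2.mem_iff_exists.1 hve
      exact ⟨u, ⟨he, hA u (Sym2.mem_mk_right v u)⟩, rfl⟩
    · exact Or.inl ⟨he, fun u hu => ⟨hA u hu, fun h => hve (h ▸ hu)⟩⟩
  have h3 : (edgesIn G A).ncard ≤ (edgesIn G (A \ {v})).ncard + degIn G A v :=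
    (Set.ncard_le_ncard h2).trans ((Set.ncard_union_le _ _).trans
      (Nat.add_le_add_left (Set.ncard_image_le) _))
  unfold delta
  have h1' : ((A \ {v}).ncard : ℤ) + 1 = A.ncard := by exact_mod_cast h1
  have h3' : ((edgesIn G A).ncard : ℤ) ≤ (edgesIn G (A \ {v})).ncard + degIn G A v := by
    exact_mod_cast h3
  have hn' : (0 : ℤ) ≤ (n : ℤ) - 2 := by omega
  rw [← h1']
  nlinarith [mul_le_mul_of_nonneg_left h3' hn']

theorem delta_add_le_delta_union [Finite V] (hn : 2 ≤ n) {A B : Set V} (hd : Disjoint A B)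
    (hAB : ∀ a ∈ A, ∀ b ∈ B, ¬ G.Adj a b) :
    delta n G A + delta n G B ≤ delta n G (A ∪ B) := by
  have h1 : (A ∪ B).ncard = A.ncard + B.ncard := Set.ncard_union_eq hd
  have h2 : edgesIn G (A ∪ B) ⊆ edgesIn G A ∪ edgesIn G B := by
    rintro e ⟨he, hA⟩
    induction e with | _ u v
    have hu := hA u (Sym2.mem_mk_left u v)
    have hv := hA v (Sym2.mem_mk_right u v)
    have he' : G.Adj u v := he
    rcases hu with hu | hu <;> rcases hv with hv | hv
    · exact Or.inl ⟨he, by simp [hu, hv]⟩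
    · exact absurd he' (hAB u hu v hv)
    · exact absurd he'.symm (hAB v hv u hu)
    · exact Or.inr ⟨he, by simp [hu, hv]⟩
  have h3 := (Set.ncard_le_ncard h2).trans (Set.ncard_union_le _ _)
  unfold delta
  have h3' : ((edgesIn G (A ∪ B)).ncard : ℤ) ≤ (edgesIn G A).ncard + (edgesIn G B).ncard := by
    exact_mod_cast h3
  have hn' : (0 : ℤ) ≤ (n : ℤ) - 2 := by omega
  rw [h1]
  push_cast
  nlinarith [mul_le_mul_of_nonneg_left h3' hn']

theorem two_le_degIn [Finite V] {A : Set V} {v a b : V} (ha : a ∈ A) (hb : b ∈ A) (hva : G.Adj v a)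
    (hvb : G.Adj v b) (hab : a ≠ b) : 2 ≤ degIn G A v := by
  rw [← Set.ncard_pair hab]
  refine Set.ncard_le_ncard ?_
  rintro u (rfl | rfl)
  exacts [⟨hva, ha⟩, ⟨hvb, hb⟩]

/-- Removing a loose end from a connected set leaves a connected set. -/
theorem ConnIn.diff_singleton [Finite V] {A : Set V} (hA : ConnIn G A) {v : V}
    (hv : degIn G A v ≤ 1) :
    ConnIn G (A \ {v}) := by
  classical
  intro x hx y hy
  obtain ⟨w, hw⟩ := hA x hx.1 y hy.1
  have hwb : ∀ u ∈ w.bypass.support, u ∈ A := fun u hu =>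
    hw u (w.support_bypass_subset_support hu)
  refine ⟨w.bypass, fun u hu => ⟨hwb u hu, ?_⟩⟩
  rintro rfl
  obtain ⟨i, rfl, hi⟩ := Walk.mem_support_iff_exists_getVert.1 hu
  have hi0 : i ≠ 0 := by
    rintro rfl
    exact hx.2 (by simp)
  have hil : i ≠ w.bypass.length := by
    rintro rfl
    exact hy.2 (by simp)
  have h1 := w.bypass.adj_getVert_succ (i := i - 1) (by omega)
  have h2 := w.bypass.adj_getVert_succ (i := i) (by omega)
  rw [Nat.sub_add_cancel (by omega)] at h1
  have := two_le_degIn (hwb _ (Walk.getVert_mem_support _ _))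
    (hwb _ (Walk.getVert_mem_support _ _)) h1.symm h2 (fun h => by
      have := w.bypass_isPath.getVert_injOn (by simp; omega) (by simp; omega) h
      omega)
  omega

/-- The interior vertices of a walk. -/
def inner {x y : V} (p : G.Walk x y) : Set V := {v | v ∈ p.support ∧ v ≠ x ∧ v ≠ y}

/-- `p` is a clean arc in `A`. -/
structure IsArc_s16 (n : ℕ) (A : Set V) {x y : V} (p : G.Walk x y) : Prop where
  isPath : p.IsPath
  length_eq : p.length = n - 1
  mem : ∀ v ∈ p.support, v ∈ A
  degIn_eq : ∀ v ∈ inner p, degIn G A v = 2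

theorem inner_reverse {x y : V} (p : G.Walk x y) : inner p.reverse = inner p := by
  ext v
  simp only [inner, Walk.support_reverse, List.mem_reverse, Set.mem_ofPred_eq]
  tauto

namespace IsArc_s16

variable {A : Set V} {x y : V} {p : G.Walk x y}

theorem reverse (hp : IsArc_s16 n A p) : IsArc_s16 n A p.reverse where
  isPath := hp.isPath.reverse
  length_eq := by rw [Walk.length_reverse, hp.length_eq]
  mem v hv := hp.mem v (by simpa using hv)
  degIn_eq v hv := hp.degIn_eq v (by rwa [inner_reverse] at hv)

theorem start_mem (hp : IsArc_s16 n A p) : x ∈ A \ inner p :=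
  ⟨hp.mem x p.start_mem_support, fun h => h.2.1 rfl⟩

theorem end_mem (hp : IsArc_s16 n A p) : y ∈ A \ inner p :=
  ⟨hp.mem y p.end_mem_support, fun h => h.2.2 rfl⟩

theorem getVert_mem_inner (hp : IsArc_s16 n A p) {i : ℕ} (h0 : 0 < i) (hi : i < n - 1) :
    p.getVert i ∈ inner p := by
  refine ⟨Walk.getVert_mem_support _ _, fun h => ?_, fun h => ?_⟩
  · rw [hp.isPath.getVert_eq_start_iff (by rw [hp.length_eq]; omega)] at h
    omega
  · rw [hp.isPath.getVert_eq_end_iff (by rw [hp.length_eq]; omega), hp.length_eq] at h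
    omega

theorem exists_getVert (hp : IsArc_s16 n A p) {v : V} (hv : v ∈ inner p) :
    ∃ i, 0 < i ∧ i < n - 1 ∧ v = p.getVert i := by
  obtain ⟨hv, hx, hy⟩ := hv
  obtain ⟨i, rfl, hi⟩ := Walk.mem_support_iff_exists_getVert.1 hv
  refine ⟨i, Nat.pos_of_ne_zero ?_, ?_, rfl⟩
  · rintro rfl
    simp at hx
  · rw [← hp.length_eq]
    refine lt_of_le_of_ne hi ?_
    rintro rfl
    simp at hy

/-- The only neighbours in `A` of an interior vertex of a clean arc are its neighbours
on the arc. -/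
theorem eq_of_adj [Finite V] (hp : IsArc_s16 n A p) {i : ℕ} (h0 : 0 < i) (hi : i < n - 1) {u : V}
    (hu : u ∈ A) (h : G.Adj (p.getVert i) u) :
    u = p.getVert (i - 1) ∨ u = p.getVert (i + 1) := by
  have hl := hp.length_eq
  have h1 := p.adj_getVert_succ (i := i - 1) (by omega)
  have h2 := p.adj_getVert_succ (i := i) (by omega)
  rw [Nat.sub_add_cancel (by omega)] at h1
  have hne : p.getVert (i - 1) ≠ p.getVert (i + 1) := fun h => by
    have := hp.isPath.getVert_injOn (by simp; omega) (by simp; omega) h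
    omega
  have hsub : {p.getVert (i - 1), p.getVert (i + 1)} ⊆ G.neighborSet (p.getVert i) ∩ A := by
    rintro v (rfl | rfl)
    exacts [⟨h1.symm, hp.mem _ (Walk.getVert_mem_support _ _)⟩,
      ⟨h2, hp.mem _ (Walk.getVert_mem_support _ _)⟩]
  have heq := Set.eq_of_subset_of_ncard_le hsub (by
    rw [Set.ncard_pair hne]
    exact (hp.degIn_eq _ (hp.getVert_mem_inner h0 hi)).le)
  have : u ∈ ({p.getVert (i - 1), p.getVert (i + 1)} : Set V) := heq ▸ ⟨h, hu⟩
  simpa using this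

theorem edge_mem [Finite V] (hp : IsArc_s16 n A p) {v u : V} (hv : v ∈ inner p) (hu : u ∈ A)
    (h : G.Adj v u) : s(v, u) ∈ p.edges := by
  obtain ⟨i, h0, hi, rfl⟩ := hp.exists_getVert hv
  have hl := hp.length_eq
  rcases hp.eq_of_adj h0 hi hu h with rfl | rfl
  · obtain ⟨j, rfl⟩ : ∃ j, i = j + 1 := ⟨i - 1, by omega⟩
    rw [Sym2.eq_swap]
    exact (Walk.mk_mem_edges_iff_exists _).2 ⟨j, by omega, by simp⟩
  · exact (Walk.mk_mem_edges_iff_exists _).2 ⟨i, by omega, by simp⟩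

theorem eq_of_adj_inner [Finite V] (hp : IsArc_s16 n A p) {v u : V} (hv : v ∈ inner p) (hu : u ∈ A)
    (h : G.Adj v u) (hui : u ∉ inner p) : u = x ∨ u = y := by
  have h1 := p.snd_mem_support_of_mem_edges (hp.edge_mem hv hu h)
  by_contra! h2
  exact hui ⟨h1, h2⟩

theorem ncard_inner (hn : 3 ≤ n) (hp : IsArc_s16 n A p) : (inner p).ncard = n - 2 := by
  have : inner p = p.getVert '' (Set.Ioo 0 (n - 1)) := by
    ext v
    constructor
    · intro hv
      obtain ⟨i, h0, hi, rfl⟩ := hp.exists_getVert hv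
      exact ⟨i, ⟨h0, hi⟩, rfl⟩
    · rintro ⟨i, ⟨h0, hi⟩, rfl⟩
      exact hp.getVert_mem_inner h0 hi
  rw [this, Set.InjOn.ncard_image, Set.ncard_eq_toFinset_card']
  · simp
    omega
  · refine hp.isPath.getVert_injOn.mono fun i hi => ?_
    simp only [Set.mem_Ioo] at hi
    simp only [Set.mem_ofPred_eq, hp.length_eq]
    omega

theorem delta_diff_le [Finite V] (hn : 3 ≤ n) (hp : IsArc_s16 n A p) :
    delta n G (A \ inner p) ≤ delta n G A := by
  classical
  have hsub : inner p ⊆ A := fun v hv => hp.mem v hv.1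
  have h1 := Set.ncard_sdiff_add_ncard_of_subset hsub
  rw [hp.ncard_inner hn] at h1
  have h2 : edgesIn G A ⊆ edgesIn G (A \ inner p) ∪ (p.edges.toFinset : Set (Sym2 V)) := by
    rintro e ⟨he, hA⟩
    by_cases hv : ∃ v ∈ e, v ∈ inner p
    · right
      obtain ⟨v, hve, hv⟩ := hv
      obtain ⟨u, rfl⟩ := Sym2.mem_iff_exists.1 hve
      simpa using hp.edge_mem hv (hA u (Sym2.mem_mk_right v u)) he
    · push Not at hv
      exact Or.inl ⟨he, fun u hu => ⟨hA u hu, hv u hu⟩⟩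
  have h3 := (Set.ncard_le_ncard h2).trans (Set.ncard_union_le _ _)
  rw [Set.ncard_coe_finset] at h3
  have h4 := p.edges.toFinset_card_le
  rw [Walk.length_edges, hp.length_eq] at h4
  obtain ⟨m, rfl⟩ : ∃ m, n = m + 2 := ⟨n - 2, by omega⟩
  have h1' : ((A \ inner p).ncard : ℤ) + m = A.ncard := by
    rw [← h1]; push_cast; simp
  have h3' : ((edgesIn G A).ncard : ℤ) ≤ (edgesIn G (A \ inner p)).ncard + (m + 1) := by
    have : (edgesIn G A).ncard ≤ (edgesIn G (A \ inner p)).ncard + (m + 1) := by omega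
    exact_mod_cast this
  unfold delta
  rw [← h1']
  push_cast
  nlinarith [mul_le_mul_of_nonneg_left h3' (Nat.cast_nonneg (α := ℤ) m)]

/-- A walk in the complement of the interior joining the ends of an arc has length
more than `n`. -/
theorem lt_length_s16 (hn : 3 ≤ n) (hg : (2 * n : ℕ∞) ≤ G.egirth) (hp : IsArc_s16 n A p)
    (w : G.Walk x y) (hw : ∀ v ∈ w.support, v ∈ A \ inner p) : n < w.length := by
  have hl := hp.length_eq
  have he : s(p.getVert 0, p.getVert 1) ∈ p.edges :=
    (Walk.mk_mem_edges_iff_exists _).2 ⟨0, by omega, by simp⟩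
  have := two_mul_le_length_add_length hg p hp.isPath w he (fun h =>
    (hw _ (w.snd_mem_support_of_mem_edges h)).2 (hp.getVert_mem_inner (by omega) (by omega)))
  omega

/-- A walk in `A` avoids the interior of an arc until it meets one of its ends. -/
theorem exists_walk_to_end [Finite V] (hp : IsArc_s16 n A p) {a b : V} (w : G.Walk a b)
    (hw : ∀ v ∈ w.support, v ∈ A) (ha : a ∉ inner p) (hb : b = x) :
    (∃ w' : G.Walk a x, ∀ v ∈ w'.support, v ∈ A \ inner p) ∨
      ∃ w' : G.Walk a y, ∀ v ∈ w'.support, v ∈ A \ inner p := by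
  induction w with
  | nil =>
    subst hb
    exact Or.inl ⟨Walk.nil, by simpa using ⟨hw _ (by simp), ha⟩⟩
  | @cons a c b h w ih =>
    have haA : a ∈ A := hw a (by simp)
    have hwA : ∀ v ∈ w.support, v ∈ A := fun v hv => hw v (by simp [hv])
    by_cases hc : c ∈ inner p
    · have hcA := hwA c w.start_mem_support
      rcases hp.eq_of_adj_inner hc haA h.symm ha with rfl | rfl
      · exact Or.inl ⟨Walk.nil, by simpa using ⟨haA, ha⟩⟩
      · exact Or.inr ⟨Walk.nil, by simpa using ⟨haA, ha⟩⟩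
    · rcases ih hwA hc hb with ⟨w', hw'⟩ | ⟨w', hw'⟩
      · exact Or.inl ⟨Walk.cons h w', by simpa using ⟨⟨haA, ha⟩, hw'⟩⟩
      · exact Or.inr ⟨Walk.cons h w', by simpa using ⟨⟨haA, ha⟩, hw'⟩⟩

end IsArc_s16

/-- The connected component of `x` in the subgraph on `B`. -/
def component (G : SimpleGraph V) (B : Set V) (x : V) : Set V :=
  {a | ∃ w : G.Walk a x, ∀ v ∈ w.support, v ∈ B}

theorem component_subset (B : Set V) (x : V) : component G B x ⊆ B := by
  rintro a ⟨w, hw⟩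
  exact hw a w.start_mem_support

theorem self_mem_component {B : Set V} {x : V} (hx : x ∈ B) : x ∈ component G B x :=
  ⟨Walk.nil, by simpa using hx⟩

theorem mem_component_of_adj {B : Set V} {x a b : V} (ha : a ∈ component G B x) (hb : b ∈ B)
    (h : G.Adj a b) : b ∈ component G B x := by
  obtain ⟨w, hw⟩ := ha
  exact ⟨Walk.cons h.symm w, by simpa using ⟨hb, hw⟩⟩

theorem connIn_component (B : Set V) (x : V) : ConnIn G (component G B x) := by
  classical
  have key : ∀ {a : V} (w : G.Walk a x), (∀ v ∈ w.support, v ∈ B) →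
      ∀ v ∈ w.support, v ∈ component G B x := fun w hw v hv =>
    ⟨w.dropUntil v hv, fun u hu => hw u (w.support_dropUntil_subset_support hv hu)⟩
  rintro a ⟨w, hw⟩ b ⟨w', hw'⟩
  refine ⟨w.append w'.reverse, fun v hv => ?_⟩
  rw [Walk.mem_support_append_iff, Walk.support_reverse, List.mem_reverse] at hv
  exact hv.elim (key w hw v) (key w' hw' v)

theorem exists_adj_ne [Finite V] {A : Set V} {v : V} (h : 2 ≤ degIn G A v) (t : V) :
    ∃ u ∈ A, G.Adj v u ∧ u ≠ t := by
  obtain ⟨u, hu, hut⟩ := Set.exists_ne_of_one_lt_ncard h t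
  exact ⟨u, hu.2, hu.1, hut⟩

namespace IsArc_s16

variable {A : Set V} {x y : V} {p : G.Walk x y}

theorem three_le_ncard_component [Finite V] (hp : IsArc_s16 n A p)
    (hdeg : ∀ v ∈ A, 2 ≤ degIn G A v)
    (hno : ¬ ∃ w : G.Walk x y, ∀ v ∈ w.support, v ∈ A \ inner p) :
    3 ≤ (component G (A \ inner p) x).ncard := by
  have hl := hp.length_eq
  have hx := hp.start_mem
  have hxc := self_mem_component (G := G) hx
  obtain ⟨u, huA, hxu, hu1⟩ := exists_adj_ne (hdeg x hx.1) (p.getVert 1)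
  have hui : u ∉ inner p := by
    intro hu
    obtain ⟨i, h0, hi, rfl⟩ := hp.exists_getVert hu
    rcases hp.eq_of_adj h0 hi hx.1 hxu.symm with h | h
    · rw [eq_comm, hp.isPath.getVert_eq_start_iff (by omega)] at h
      obtain rfl : i = 1 := by omega
      exact hu1 rfl
    · rw [eq_comm, hp.isPath.getVert_eq_start_iff (by omega)] at h
      omega
  have huc := mem_component_of_adj hxc ⟨huA, hui⟩ hxu
  obtain ⟨w, hwA, huw, hwx⟩ := exists_adj_ne (hdeg u huA) x
  have hwi : w ∉ inner p := by
    intro hw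
    rcases hp.eq_of_adj_inner hw huA huw.symm hui with rfl | rfl
    · exact hxu.ne rfl
    · obtain ⟨q, hq⟩ := huc
      exact hno ⟨q.reverse, fun v hv => hq v (by simpa using hv)⟩
  have hwc := mem_component_of_adj huc ⟨hwA, hwi⟩ huw
  exact (Set.two_lt_ncard (Set.toFinite _)).2 ⟨x, hxc, u, huc, w, hwc, hxu.ne, hwx.symm, huw.ne⟩

/-- If removing a clean arc disconnects a connected set without loose ends, then the rank is
at least the sum of the ranks of two smaller connected pieces with at least three vertices. -/
theorem exists_pieces [Finite V] (hn : 3 ≤ n) (hp : IsArc_s16 n A p) (hA : ConnIn G A)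
    (hdeg : ∀ v ∈ A, 2 ≤ degIn G A v) (hB : ¬ ConnIn G (A \ inner p)) :
    ∃ S T : Set V, S ⊆ A \ inner p ∧ T ⊆ A \ inner p ∧ ConnIn G S ∧ ConnIn G T ∧
      3 ≤ S.ncard ∧ 3 ≤ T.ncard ∧ delta n G S + delta n G T ≤ delta n G A := by
  have hreach : ∀ a ∈ A \ inner p,
      a ∈ component G (A \ inner p) x ∨ a ∈ component G (A \ inner p) y := fun a ha => by
    obtain ⟨w, hw⟩ := hA a ha.1 x hp.start_mem.1
    exact hp.exists_walk_to_end w hw ha.2 rfl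
  have hno : ¬ ∃ w : G.Walk x y, ∀ v ∈ w.support, v ∈ A \ inner p := by
    rintro ⟨w, hw⟩
    have hall : component G (A \ inner p) y = A \ inner p := by
      refine (component_subset _ _).antisymm fun a ha => ?_
      rcases hreach a ha with ⟨q, hq⟩ | h
      · refine ⟨q.append w, fun v hv => ?_⟩
        rw [Walk.mem_support_append_iff] at hv
        exact hv.elim (hq v) (hw v)
      · exact h
    exact hB (hall ▸ connIn_component _ _)
  have hno' : ¬ ∃ w : G.Walk y x, ∀ v ∈ w.support, v ∈ A \ inner p.reverse := by
    rintro ⟨w, hw⟩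
    rw [inner_reverse] at hw
    exact hno ⟨w.reverse, fun v hv => hw v (by simpa using hv)⟩
  have h1 := hp.three_le_ncard_component hdeg hno
  have h2 := hp.reverse.three_le_ncard_component hdeg hno'
  rw [inner_reverse] at h2
  have hdisj : Disjoint (component G (A \ inner p) x) (component G (A \ inner p) y) := by
    rw [Set.disjoint_left]
    rintro a ⟨w, hw⟩ ⟨w', hw'⟩
    refine hno ⟨w.reverse.append w', fun v hv => ?_⟩
    rw [Walk.mem_support_append_iff, Walk.support_reverse, List.mem_reverse] at hv
    exact hv.elim (hw v) (hw' v)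
  have hunion : component G (A \ inner p) x ∪ component G (A \ inner p) y = A \ inner p :=
    (Set.union_subset (component_subset _ _) (component_subset _ _)).antisymm hreach
  refine ⟨_, _, component_subset _ x, component_subset _ y, connIn_component _ _,
    connIn_component _ _, h1, h2, ?_⟩
  refine le_trans ?_ (hp.delta_diff_le hn)
  nth_rw 3 [← hunion]
  exact delta_add_le_delta_union (by omega) hdisj fun a ha b hb hab =>
    Set.disjoint_left.1 hdisj (mem_component_of_adj ha (component_subset _ _ hb) hab) hb

/-- Attaching a clean arc to a connected set with at most `n + 3` vertices without creating
loose ends gives an ordinary `n`-gon. -/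
theorem isRound [Finite V] (hn : 3 ≤ n) (hbip : IsBipartite G)
    (hg : (2 * n : ℕ∞) ≤ G.egirth) (hp : IsArc_s16 n A p)
    (hdeg : ∀ v ∈ A, 2 ≤ degIn G A v) (hB : ConnIn G (A \ inner p))
    (hcard : (A \ inner p).ncard ≤ n + 3) : IsRound n G A ∧ n + 2 ≤ (A \ inner p).ncard := by
  classical
  have hl := hp.length_eq
  obtain ⟨w, hw⟩ := hB x hp.start_mem y hp.end_mem
  set q := w.bypass with hq
  have hqB : ∀ v ∈ q.support, v ∈ A \ inner p := fun v hv =>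
    hw v (w.support_bypass_subset_support hv)
  have hqp : q.IsPath := w.bypass_isPath
  have hlt := hp.lt_length_s16 hn hg q hqB
  have hsub : (q.support.toFinset : Set V) ⊆ A \ inner p := fun v hv => hqB v (by simpa using hv)
  have hqc : (q.support.toFinset : Set V).ncard = q.length + 1 := by
    rw [Set.ncard_coe_finset, List.toFinset_card_of_nodup hqp.support_nodup, Walk.length_support]
  have hle := Set.ncard_le_ncard hsub
  have hlen : q.length = n + 1 := by
    obtain ⟨c, hc⟩ := hbip
    let C : G.Coloring Bool := SimpleGraph.Coloring.mk c (fun {u v} h => hc h)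
    have h1 := C.even_length_iff_congr p
    have h2 := C.even_length_iff_congr q
    have h3 : Even p.length ↔ Even q.length := h1.trans h2.symm
    rw [hl, Nat.even_iff, Nat.even_iff] at h3
    omega
  have hall : ∀ v ∈ A \ inner p, v ∈ q.support := by
    intro l hlB
    by_contra hlq
    have huniq : ∀ u ∈ A \ inner p, u ∉ q.support → u = l := by
      intro u hu huq
      by_contra hne
      have h1 : (insert u (insert l (q.support.toFinset : Set V))) ⊆ A \ inner p :=
        Set.insert_subset hu (Set.insert_subset hlB hsub)
      have h2 := Set.ncard_le_ncard h1
      rw [Set.ncard_insert_of_notMem (by simp [huq, hne]),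
        Set.ncard_insert_of_notMem (by simpa using hlq)] at h2
      omega
    have hnb : ∀ u ∈ A, G.Adj l u → u ∈ q.support := by
      intro u hu hlu
      by_contra huq
      have hui : u ∉ inner p := fun hui => by
        rcases hp.eq_of_adj_inner hui hlB.1 hlu.symm hlB.2 with rfl | rfl
        · exact hlq q.start_mem_support
        · exact hlq q.end_mem_support
      exact hlu.ne (huniq u ⟨hu, hui⟩ huq).symm
    obtain ⟨a, haA, hla, -⟩ := exists_adj_ne (hdeg l hlB.1) l
    obtain ⟨b, hbA, hlb, hba⟩ := exists_adj_ne (hdeg l hlB.1) a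
    have key : ∀ i j : ℕ, i < j → j ≤ q.length → G.Adj l (q.getVert i) →
        G.Adj l (q.getVert j) → False := by
      intro i j hij hj hi' hj'
      have hw1 := hp.lt_length_s16 hn hg
        ((q.take i).append (Walk.cons hi'.symm (Walk.cons hj' (q.drop j)))) (by
          intro v hv
          simp only [Walk.mem_support_append_iff, Walk.support_cons, List.mem_cons] at hv
          rcases hv with hv | rfl | rfl | hv
          · exact hqB v ((q.isSubwalk_take i).support_subset hv)
          · exact hqB _ (q.getVert_mem_support i)
          · exact hlB
          · exact hqB v ((q.isSubwalk_drop j).support_subset hv))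
      simp only [Walk.length_append, Walk.length_cons, Walk.take_length, Walk.drop_length] at hw1
      have hji : i + (j - i) = j := by omega
      let r : G.Walk (q.getVert i) (q.getVert j) :=
        ((q.drop i).take (j - i)).copy rfl (by rw [Walk.drop_getVert, hji])
      have hrlen : r.length = j - i := by
        simp [r, Walk.take_length, Walk.drop_length]
        omega
      have hrs : l ∉ r.support := by
        intro h
        rw [Walk.support_copy] at h
        exact hlq ((q.isSubwalk_drop i).support_subset
          (((q.drop i).isSubwalk_take (j - i)).support_subset h))
      have := two_mul_le_length_add_one hg hi' (r.concat hj'.symm) (by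
        rw [Walk.edges_concat, List.concat_eq_append, List.mem_append]
        rintro (h | h)
        · exact hrs (r.fst_mem_support_of_mem_edges h)
        · rw [List.mem_singleton, Sym2.eq_swap, Sym2.congr_left] at h
          have := hqp.getVert_injOn (by simp; omega) (by simp; omega) h
          omega)
      rw [Walk.length_concat, hrlen] at this
      omega
    obtain ⟨i, rfl, hi⟩ := Walk.mem_support_iff_exists_getVert.1 (hnb a haA hla)
    obtain ⟨j, rfl, hj⟩ := Walk.mem_support_iff_exists_getVert.1 (hnb b hbA hlb)
    rcases lt_trichotomy i j with h | rfl | h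
    · exact key i j h hj hla hlb
    · exact hba rfl
    · exact key j i h hi hlb hla
  refine ⟨⟨x, p.append q.reverse, ?_, fun v => ?_⟩, by omega⟩
  · rw [Walk.length_append, Walk.length_reverse]
    omega
  · rw [Walk.mem_support_append_iff, Walk.support_reverse, List.mem_reverse]
    constructor
    · intro hv
      by_cases hi : v ∈ inner p
      · exact Or.inl hi.1
      · exact Or.inr (hall v ⟨hv, hi⟩)
    · rintro (hv | hv)
      exacts [hp.mem v hv, (hqB v hv).1]

theorem eq_or_eq_of_isRound (hn : 3 ≤ n) (hg : (2 * n : ℕ∞) ≤ G.egirth) (hp : IsArc_s16 n A p)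
    {l : V} (hr : IsRound n G ((A \ inner p) \ {l})) : x = l ∨ y = l := by
  by_contra! h
  obtain ⟨w, hw, hwn⟩ := hr.diamLE x ⟨hp.start_mem, h.1⟩ y ⟨hp.end_mem, h.2⟩
  exact absurd (hp.lt_length_s16 hn hg w fun v hv => (hw v hv).1) (by omega)

/-- Attaching a clean arc to an ordinary `n`-gon with a loose end `x` gives a set of
diameter at most `n`. -/
theorem diamLE_of_isRound (hn : 3 ≤ n) (hg : (2 * n : ℕ∞) ≤ G.egirth)
    (hp : IsArc_s16 n A p) (hB : ConnIn G (A \ inner p))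
    (hr : IsRound n G ((A \ inner p) \ {x})) : DiamLE n G A := by
  have hl := hp.length_eq
  have hxy : x ≠ y := fun h => by
    have := hp.isPath.getVert_eq_end_iff (i := 0) (by omega)
    simp only [Walk.getVert_zero] at this
    have := this.1 h
    omega
  obtain ⟨w, hw⟩ := hB x hp.start_mem y hp.end_mem
  obtain ⟨z, h, hzB⟩ : ∃ z, G.Adj x z ∧ z ∈ A \ inner p := by
    cases w with
    | nil => exact absurd rfl hxy
    | @cons _ z _ h w => exact ⟨z, h, hw z (by simp)⟩
  obtain ⟨q, q', hqq, hD⟩ := hr.exists_split ⟨hzB, h.ne'⟩ ⟨hp.end_mem, hxy.symm⟩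
  have hqB : ∀ v ∈ q.support, v ∈ A \ inner p := fun v hv => ((hD v).2 (Or.inl hv)).1
  have hqB' : ∀ v ∈ q'.support, v ∈ A \ inner p := fun v hv => ((hD v).2 (Or.inr hv)).1
  have h1 := hp.lt_length_s16 hn hg (Walk.cons h q) (by simpa using ⟨hp.start_mem, hqB⟩)
  have h2 := hp.lt_length_s16 hn hg (Walk.cons h q'.reverse) (by
    simpa using ⟨hp.start_mem, hqB'⟩)
  simp only [Walk.length_cons, Walk.length_reverse] at h1 h2
  have key : ∀ r : G.Walk y z, r.length = n → (∀ v ∈ r.support, v ∈ A) →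
      ∀ a ∈ A, ∀ b ∈ A, (a ∈ p.support ∨ a ∈ r.support) → (b ∈ p.support ∨ b ∈ r.support) →
      ∃ w : G.Walk a b, (∀ v ∈ w.support, v ∈ A) ∧ w.length ≤ n := by
    intro r hr hrA a ha b hb ha' hb'
    let c : G.Walk x x := p.append (r.append (Walk.cons h.symm Walk.nil))
    have hc : c.length = 2 * n := by
      simp only [c, Walk.length_append, Walk.length_cons, Walk.length_nil]
      omega
    have hcs : ∀ v, v ∈ p.support ∨ v ∈ r.support → v ∈ c.support := by
      intro v hv
      simp only [c, Walk.mem_support_append_iff]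
      tauto
    have hcA : ∀ v ∈ c.support, v ∈ A := by
      intro v hv
      simp only [c, Walk.mem_support_append_iff, Walk.support_cons, Walk.support_nil,
        List.mem_cons, List.not_mem_nil, or_false] at hv
      rcases hv with hv | hv | rfl | rfl
      exacts [hp.mem v hv, hrA v hv, hzB.1, hp.start_mem.1]
    obtain ⟨w, hw, hwn⟩ := IsRound.diamLE (A := {v | v ∈ c.support}) ⟨x, c, hc, fun _ => Iff.rfl⟩
      a (hcs a ha') b (hcs b hb')
    exact ⟨w, fun v hv => hcA v (hw v hv), hwn⟩
  have key1 := key q.reverse (by rw [Walk.length_reverse]; omega)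
    (fun v hv => (hqB v (by simpa using hv)).1)
  have key2 := key q' (by omega) (fun v hv => (hqB' v hv).1)
  simp only [Walk.support_reverse, List.mem_reverse] at key1
  have hcov : ∀ a ∈ A, a ∈ p.support ∨ a ∈ (A \ inner p) \ {x} := by
    intro a ha
    by_cases hax : a = x
    · exact Or.inl (hax ▸ p.start_mem_support)
    · by_cases hai : a ∈ inner p
      · exact Or.inl hai.1
      · exact Or.inr ⟨⟨ha, hai⟩, hax⟩
  intro a ha b hb
  rcases hcov a ha with ha' | ha' <;> rcases hcov b hb with hb' | hb'
  · exact key1 a ha b hb (Or.inl ha') (Or.inl hb')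
  · rcases (hD b).1 hb' with h' | h'
    · exact key1 a ha b hb (Or.inl ha') (Or.inr h')
    · exact key2 a ha b hb (Or.inl ha') (Or.inr h')
  · rcases (hD a).1 ha' with h' | h'
    · exact key1 a ha b hb (Or.inr h') (Or.inl hb')
    · exact key2 a ha b hb (Or.inr h') (Or.inl hb')
  · obtain ⟨w, hw, hwn⟩ := hr.diamLE a ha' b hb'
    exact ⟨w, fun v hv => (hw v hv).1.1, hwn⟩

/-- In an ordinary `n`-gon with a loose end `x`, every path from `x` to a vertex at distance
more than `n` has length at most `n + 1`. -/
theorem length_le_of_isRound (hn : 3 ≤ n) (hg : (2 * n : ℕ∞) ≤ G.egirth)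
    (hp : IsArc_s16 n A p) (hr : IsRound n G ((A \ inner p) \ {x})) (q : G.Walk x y)
    (hq : q.IsPath) (hqB : ∀ v ∈ q.support, v ∈ A \ inner p) : q.length ≤ n + 1 := by
  cases q with
  | nil => simp
  | @cons _ z _ h q =>
    rw [Walk.cons_isPath_iff] at hq
    have hqD : ∀ v ∈ q.support, v ∈ (A \ inner p) \ {x} := fun v hv =>
      ⟨hqB v (by simp [hv]), fun hvx => hq.2 (hvx ▸ hv)⟩
    obtain ⟨a, ha⟩ := hr.exists_antipode (hqD z q.start_mem_support)
    have hya : y = a := by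
      by_contra hya
      obtain ⟨w, hw, hwn⟩ := ha y (hqD y q.end_mem_support) hya
      have := hp.lt_length_s16 hn hg (Walk.cons h w) (by
        simpa using ⟨hp.start_mem, fun v hv => (hw v hv).1⟩)
      rw [Walk.length_cons] at this
      omega
    rw [Walk.length_cons]
    by_contra! hlen
    obtain ⟨w, -, hwn⟩ := ha (q.getVert n) (hqD _ (q.getVert_mem_support n)) (fun h => by
      rw [← hya, hq.1.getVert_eq_end_iff (by omega)] at h
      omega)
    have htl : (q.take n).length = n := by
      rw [Walk.take_length]
      omega
    have := two_mul_le_of_length_lt hg (q.take n) (hq.1.take n) w (by omega)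
    omega

theorem getVert_eq_of_isCycle [Finite V] (hp : IsArc_s16 n A p) {r : V} {c : G.Walk r r}
    (hc : c.IsCycle) (hcA : ∀ v ∈ c.support, v ∈ A) (hlen : n ≤ c.length) {j : ℕ} (h0 : 0 < j)
    (hj : r = p.getVert j) (h1 : c.getVert 1 = p.getVert (j + 1)) (i : ℕ)
    (hi : j + i + 1 ≤ n - 1) :
    c.getVert i = p.getVert (j + i) ∧ c.getVert (i + 1) = p.getVert (j + i + 1) := by
  induction i with
  | zero => simpa [hj] using h1
  | succ i ih =>
    obtain ⟨ih1, ih2⟩ := ih (by omega)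
    refine ⟨ih2, ?_⟩
    have hadj := c.adj_getVert_succ (i := i + 1) (by omega)
    rw [ih2] at hadj
    rcases hp.eq_of_adj (by omega) (by omega) (hcA _ (c.getVert_mem_support _)) hadj with h | h
    · rw [Nat.add_sub_cancel, ← ih1] at h
      exact absurd h.symm (hc.getVert_sub_one_ne_getVert_add_one (i := i + 1) (by omega))
    · exact h

theorem exists_complement_of_getVert_one [Finite V] (hp : IsArc_s16 n A p)
    {r : V} {c : G.Walk r r} (hc : c.IsCycle) (hcA : ∀ v ∈ c.support, v ∈ A)
    (hlen : n ≤ c.length) {j : ℕ} (h0 : 0 < j) (hjn : j < n - 1)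
    (hj : r = p.getVert j) (h1 : c.getVert 1 = p.getVert (j + 1)) :
    ∃ q : G.Walk y x, q.IsPath ∧ (∀ v ∈ q.support, v ∈ A \ inner p) ∧
      q.length + (n - 1) = c.length := by
  have hl := hp.length_eq
  have h3 := hc.three_le_length
  have hinj := hc.getVert_injOn
  have hlast : c.getVert (c.length - 1) = p.getVert (j - 1) := by
    have hadj := c.adj_getVert_succ (i := c.length - 1) (by omega)
    rw [Nat.sub_add_cancel (by omega), Walk.getVert_length] at hadj
    have hadj' : G.Adj (p.getVert j) (c.getVert (c.length - 1)) :=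
      (congrArg (G.Adj · (c.getVert (c.length - 1))) hj).mp hadj.symm
    rcases hp.eq_of_adj h0 hjn (hcA _ (c.getVert_mem_support _)) hadj' with h | h
    · exact h
    · rw [← h1] at h
      have := hinj (by simp; omega) (by simp; omega) h
      omega
  have hup : ∀ i, j ≤ i → i ≤ n - 1 → c.getVert (i - j) = p.getVert i := by
    intro i hi hi'
    rcases hi.eq_or_lt with rfl | hi
    · simpa using hj
    · have := (hp.getVert_eq_of_isCycle hc hcA hlen h0 hj h1 (i - j - 1) (by omega)).2
      convert this using 2 <;> omega
  have hdown : ∀ i, i < j → c.getVert (c.length - (j - i)) = p.getVert i := by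
    intro i hi
    have := (hp.reverse.getVert_eq_of_isCycle (c := c.reverse) hc.reverse
      (fun v hv => hcA v (by simpa using hv)) (by simpa using hlen) (j := n - 1 - j) (by omega)
      (by rw [Walk.getVert_reverse, hj]; congr 1; omega)
      (by
        rw [Walk.getVert_reverse, Walk.getVert_reverse, hlast]
        congr 1
        omega) (j - i - 1) (by omega)).2
    rw [Walk.getVert_reverse, Walk.getVert_reverse] at this
    convert this using 2 <;> omega
  have hy : c.getVert (n - 1 - j) = y := by
    rw [hup (n - 1) (by omega) le_rfl, ← hl, Walk.getVert_length]
  have hx : (c.drop (n - 1 - j)).getVert (c.length - (n - 1)) = x := by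
    have := hdown 0 h0
    rw [Walk.getVert_zero] at this
    rw [Walk.drop_getVert, ← this]
    congr 1
    omega
  have hlen' : ((c.drop (n - 1 - j)).take (c.length - (n - 1))).length =
      c.length - (n - 1) := by
    rw [Walk.take_length, Walk.drop_length]
    omega
  refine ⟨((c.drop (n - 1 - j)).take (c.length - (n - 1))).copy hy hx, ?_, ?_, ?_⟩
  · rw [Walk.isPath_copy, ← Walk.IsPath.getVert_injOn_iff, hlen']
    intro a ha b hb hab
    simp only [Set.mem_ofPred_eq] at ha hb
    rw [Walk.take_getVert, Walk.take_getVert, Walk.drop_getVert, Walk.drop_getVert] at hab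
    have := hinj (by simp; omega) (by simp; omega) hab
    omega
  · intro v hv
    rw [Walk.support_copy, Walk.mem_support_iff_exists_getVert] at hv
    obtain ⟨k, rfl, hk⟩ := hv
    rw [hlen'] at hk
    rw [Walk.take_getVert, Walk.drop_getVert, Nat.min_eq_right hk]
    refine ⟨hcA _ (c.getVert_mem_support _), fun hv => ?_⟩
    obtain ⟨i, hi0, hin, hi⟩ := hp.exists_getVert hv
    rcases lt_trichotomy i j with hij | rfl | hij
    · rw [← hdown i hij] at hi
      have := hinj (by simp; omega) (by simp; omega) hi
      omega
    · have := hinj (by simp; omega) (by simp; omega)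
        (hi.trans (hj.symm.trans c.getVert_length.symm))
      omega
    · rw [← hup i hij.le (by omega)] at hi
      have := hinj (by simp; omega) (by simp; omega) hi
      omega
  · rw [Walk.length_copy, hlen']
    omega

/-- A cycle meeting the interior of a clean arc consists of this arc and a path avoiding
its interior. -/
theorem exists_complement [Finite V] (hp : IsArc_s16 n A p)
    {r : V} {c : G.Walk r r} (hc : c.IsCycle) (hcA : ∀ v ∈ c.support, v ∈ A)
    (hlen : n ≤ c.length) (hr : r ∈ inner p) :
    ∃ q : G.Walk x y, q.IsPath ∧ (∀ v ∈ q.support, v ∈ A \ inner p) ∧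
      q.length + (n - 1) = c.length := by
  obtain ⟨j, h0, hjn, rfl⟩ := hp.exists_getVert hr
  have hl := hp.length_eq
  have h3 := hc.three_le_length
  have hadj := c.adj_getVert_succ (i := 0) (by omega)
  rw [Walk.getVert_zero] at hadj
  rcases hp.eq_of_adj h0 hjn (hcA _ (c.getVert_mem_support _)) hadj with h | h
  · obtain ⟨q, hq, hqB, hql⟩ := hp.reverse.exists_complement_of_getVert_one hc hcA hlen
      (j := n - 1 - j) (by omega) (by omega)
      (by rw [Walk.getVert_reverse]; congr 1; omega)
      (by rw [Walk.getVert_reverse, h]; congr 1; omega)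
    exact ⟨q, hq, by rwa [inner_reverse] at hqB, hql⟩
  · obtain ⟨q, hq, hqB, hql⟩ := hp.exists_complement_of_getVert_one hc hcA hlen h0 hjn rfl h
    exact ⟨q.reverse, hq.reverse, fun v hv => hqB v (by simpa using hv), by simpa using hql⟩

end IsArc_s16

section Main

variable {A : Set V}

theorem delta_diff_singleton_add_one_le [Finite V] (hn : 3 ≤ n) {v : V} (hv : v ∈ A)
    (hd : degIn G A v ≤ 1) : delta n G (A \ {v}) + 1 ≤ delta n G A := by
  have h := delta_diff_singleton (G := G) (n := n) (by omega) A hv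
  have hd' : (degIn G A v : ℤ) ≤ 1 := by exact_mod_cast hd
  have hn' : (0 : ℤ) ≤ (n : ℤ) - 2 := by omega
  nlinarith [mul_le_mul_of_nonneg_left hd' hn']

/-- A nonempty set of vertices of an open graph has a loose end, or contains a clean arc. -/
theorem IsOpenGraph.exists_looseEnd_or_arc [Finite V] (hopen : IsOpenGraph n G) (hne : A.Nonempty) :
    (∃ v ∈ A, degIn G A v ≤ 1) ∨
      (∀ v ∈ A, 2 ≤ degIn G A v) ∧ ∃ (x y : V) (p : G.Walk x y), IsArc_s16 n A p := by
  by_cases hl : ∃ v ∈ A, degIn G A v ≤ 1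
  · exact Or.inl hl
  · rcases hopen A (Set.subset_univ _) (Set.toFinite _) hne with h | h
    · exact absurd h hl
    · obtain ⟨x, y, γ, -, -, -, p, hp, hlen, hmem, rfl, hdeg⟩ := h
      push Not at hl
      exact Or.inr ⟨hl, x, y, p, hp, hlen, hmem, hdeg⟩

theorem IsArc_s16.ncard_diff_lt [Finite V] (hn : 3 ≤ n) {x y : V} {p : G.Walk x y} (hp : IsArc_s16 n A p) :
    (A \ inner p).ncard < A.ncard := by
  have h := Set.ncard_sdiff_add_ncard_of_subset (show inner p ⊆ A from fun v hv => hp.mem v hv.1)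
  rw [hp.ncard_inner hn] at h
  omega

/-- The possible shapes of a nonempty connected set of vertices of rank less than `2n + 2`. -/
def SmallRank (n : ℕ) (G : SimpleGraph V) (A : Set V) : Prop :=
  (A.ncard : ℤ) + n - 2 ≤ delta n G A ∨
  (2 * (n : ℤ) ≤ delta n G A ∧ IsRound n G A) ∨
  (2 * (n : ℤ) + 1 ≤ delta n G A ∧ ((∃ l ∈ A, IsRound n G (A \ {l})) ∨ DiamLE n G A))

theorem SmallRank.add_one_le_delta (hn : 3 ≤ n) (hA : 3 ≤ A.ncard)
    (h : 2 * (n : ℤ) + 2 ≤ delta n G A ∨ SmallRank n G A) : (n : ℤ) + 1 ≤ delta n G A := by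
  rcases h with h | h | ⟨h, -⟩ | ⟨h, -⟩ <;> omega

theorem IsArc_s16.isRound_or_of_smallRank [Finite V] (hn : 3 ≤ n) (hbip : IsBipartite G)
    (hg : (2 * n : ℕ∞) ≤ G.egirth) (hdeg : ∀ v ∈ A, 2 ≤ degIn G A v) {x y : V}
    {p : G.Walk x y} (hp : IsArc_s16 n A p) (hB : ConnIn G (A \ inner p))
    (h : SmallRank n G (A \ inner p)) : 2 * (n : ℤ) + 2 ≤ delta n G A ∨ SmallRank n G A := by
  have hle := hp.delta_diff_le hn
  have hno : ¬ DiamLE n G (A \ inner p) := fun hD => by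
    obtain ⟨w, hw, hwn⟩ := hD x hp.start_mem y hp.end_mem
    exact absurd (hp.lt_length_s16 hn hg w hw) (by omega)
  rcases h with h | ⟨-, h⟩ | ⟨h, ⟨l, -, hr⟩ | h'⟩
  · by_cases hc : (A \ inner p).ncard ≤ n + 3
    · obtain ⟨hA, hc'⟩ := hp.isRound hn hbip hg hdeg hB hc
      exact Or.inr (Or.inr (Or.inl ⟨by omega, hA⟩))
    · exact Or.inl (by omega)
  · exact absurd h.diamLE hno
  · refine Or.inr (Or.inr (Or.inr ⟨by omega, Or.inr ?_⟩))
    rcases hp.eq_or_eq_of_isRound hn hg hr with rfl | rfl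
    · exact hp.diamLE_of_isRound hn hg hB hr
    · rw [← inner_reverse] at hB hr
      exact hp.reverse.diamLE_of_isRound hn hg hB hr
  · exact absurd h' hno

theorem two_mul_add_two_le_or_smallRank [Finite V] (hn : 3 ≤ n) (hbip : IsBipartite G)
    (hg : (2 * n : ℕ∞) ≤ G.egirth) (hopen : IsOpenGraph n G) (hA : ConnIn G A)
    (hne : A.Nonempty) : 2 * (n : ℤ) + 2 ≤ delta n G A ∨ SmallRank n G A := by
  induction hm : A.ncard using Nat.strong_induction_on generalizing A with
  | _ m ih =>
  subst hm
  rcases hopen.exists_looseEnd_or_arc hne with ⟨v, hv, hd⟩ | ⟨hdeg, x, y, p, hp⟩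
  · have hcard : (A \ {v}).ncard + 1 = A.ncard := Set.ncard_sdiff_singleton_add_one hv
    have hle := delta_diff_singleton_add_one_le hn hv hd
    rcases (A \ {v}).eq_empty_or_nonempty with he | he
    · obtain rfl : A = {v} := Set.Subset.antisymm (Set.sdiff_eq_empty.1 he) (by simpa using hv)
      have h0 : edgesIn G {v} = ∅ := by
        refine Set.eq_empty_of_forall_notMem ?_
        rintro e ⟨hab, h⟩
        induction e with | _ a b
        obtain rfl : a = v := h a (Sym2.mem_mk_left a b)
        obtain rfl : b = a := h b (Sym2.mem_mk_right a b)
        exact G.loopless.irrefl _ hab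
      refine Or.inr (Or.inl ?_)
      simp only [delta, h0, Set.ncard_singleton, Set.ncard_empty]
      push_cast
      linarith
    · rcases ih _ (by omega) (hA.diff_singleton hd) he rfl with h | h | ⟨h, hr⟩ | ⟨h, -⟩
      · exact Or.inl (by omega)
      · exact Or.inr (Or.inl (by omega))
      · exact Or.inr (Or.inr (Or.inr ⟨by omega, Or.inl ⟨v, hv, hr⟩⟩))
      · exact Or.inl (by omega)
  · have hlt := hp.ncard_diff_lt hn
    by_cases hB : ConnIn G (A \ inner p)
    · rcases ih _ hlt hB ⟨x, hp.start_mem⟩ rfl with h | h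
      · exact Or.inl (h.trans (hp.delta_diff_le hn))
      · exact hp.isRound_or_of_smallRank hn hbip hg hdeg hB h
    · obtain ⟨S, T, hS, hT, hSc, hTc, hS3, hT3, hle⟩ := hp.exists_pieces hn hA hdeg hB
      have hSl := Set.ncard_le_ncard hS
      have hTl := Set.ncard_le_ncard hT
      have h1 := SmallRank.add_one_le_delta hn hS3
        (ih _ (by omega) hSc (Set.nonempty_of_ncard_ne_zero (by omega)) rfl)
      have h2 := SmallRank.add_one_le_delta hn hT3
        (ih _ (by omega) hTc (Set.nonempty_of_ncard_ne_zero (by omega)) rfl)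
      exact Or.inl (by omega)

theorem two_le_degIn_of_mem_support [Finite V] {r v : V} {c : G.Walk r r} (hc : c.IsCycle)
    (hcA : ∀ u ∈ c.support, u ∈ A) (hv : v ∈ c.support) : 2 ≤ degIn G A v := by
  classical
  have hc' := hc.rotate hv
  have hm : ∀ i, (c.rotate v hv).getVert i ∈ A := fun i =>
    hcA _ ((c.mem_support_rotate_iff v hv).1 (Walk.getVert_mem_support _ i))
  have h3 := hc'.three_le_length
  have h1 := (c.rotate v hv).adj_getVert_succ (i := 0) (by omega)
  have h2 := (c.rotate v hv).adj_getVert_succ (i := (c.rotate v hv).length - 1) (by omega)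
  rw [Walk.getVert_zero] at h1
  rw [Nat.sub_add_cancel (by omega), Walk.getVert_length] at h2
  refine two_le_degIn (hm _) (hm _) h1 h2.symm fun h => ?_
  have := hc'.getVert_injOn (Set.mem_ofPred_eq ▸ ⟨by omega, by omega⟩)
    (Set.mem_ofPred_eq ▸ ⟨by omega, by omega⟩) h
  omega

/-- A connected set containing a cycle of length greater than `2n` has rank at least
`2n + 2`. -/
theorem two_mul_add_two_le_delta [Finite V] (hn : 3 ≤ n) (hbip : IsBipartite G)
    (hg : (2 * n : ℕ∞) ≤ G.egirth) (hopen : IsOpenGraph n G) (hA : ConnIn G A) {r : V}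
    {c : G.Walk r r} (hc : c.IsCycle) (hcA : ∀ u ∈ c.support, u ∈ A)
    (hlen : 2 * n + 2 ≤ c.length) : 2 * (n : ℤ) + 2 ≤ delta n G A := by
  classical
  induction hm : A.ncard using Nat.strong_induction_on generalizing A with
  | _ m ih =>
  subst hm
  have hne : A.Nonempty := ⟨r, hcA r c.start_mem_support⟩
  rcases hopen.exists_looseEnd_or_arc hne with ⟨v, hv, hd⟩ | ⟨hdeg, x, y, p, hp⟩
  · have hcard : (A \ {v}).ncard + 1 = A.ncard := Set.ncard_sdiff_singleton_add_one hv
    have hle := delta_diff_singleton_add_one_le hn hv hd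
    have := ih _ (by omega) (hA.diff_singleton hd) (fun u hu => ⟨hcA u hu, fun huv => by
      have := two_le_degIn_of_mem_support hc hcA hu
      rw [huv] at this
      omega⟩) rfl
    omega
  · have hle := hp.delta_diff_le hn
    by_cases hB : ConnIn G (A \ inner p)
    · by_cases hr : ∃ s ∈ c.support, s ∈ inner p
      · obtain ⟨s, hs, hsp⟩ := hr
        obtain ⟨q, hq, hqB, hql⟩ := hp.exists_complement (hc.rotate hs)
          (fun u hu => hcA u ((c.mem_support_rotate_iff s hs).1 hu))
          (by rw [Walk.length_rotate]; omega) hsp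
        rw [Walk.length_rotate] at hql
        have hno : ¬ DiamLE n G (A \ inner p) := fun hD => by
          obtain ⟨w, hw, hwn⟩ := hD x hp.start_mem y hp.end_mem
          exact absurd (hp.lt_length_s16 hn hg w hw) (by omega)
        rcases two_mul_add_two_le_or_smallRank hn hbip hg hopen hB ⟨x, hp.start_mem⟩ with
          h | h | ⟨-, h⟩ | ⟨-, ⟨l, -, hr⟩ | h⟩
        · exact h.trans hle
        · have hsub : (q.support.toFinset : Set V) ⊆ A \ inner p := fun v hv =>
            hqB v (by simpa using hv)
          have hqc := Set.ncard_le_ncard hsub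
          rw [Set.ncard_coe_finset, List.toFinset_card_of_nodup hq.support_nodup,
            Walk.length_support] at hqc
          omega
        · exact absurd h.diamLE hno
        · rcases hp.eq_or_eq_of_isRound hn hg hr with rfl | rfl
          · have := hp.length_le_of_isRound hn hg hr q hq hqB
            omega
          · rw [← inner_reverse] at hr
            have := hp.reverse.length_le_of_isRound hn hg hr q.reverse hq.reverse
              (fun v hv => by
                rw [inner_reverse]
                exact hqB v (by simpa using hv))
            rw [Walk.length_reverse] at this
            omega
        · exact absurd h hno
      · push Not at hr
        exact (ih _ (hp.ncard_diff_lt hn) hB (fun u hu => ⟨hcA u hu, hr u hu⟩) rfl).trans hle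
    · obtain ⟨S, T, -, -, hSc, hTc, hS3, hT3, hle⟩ := hp.exists_pieces hn hA hdeg hB
      have h1 := SmallRank.add_one_le_delta hn hS3 (two_mul_add_two_le_or_smallRank hn hbip hg
        hopen hSc (Set.nonempty_of_ncard_ne_zero (by omega)))
      have h2 := SmallRank.add_one_le_delta hn hT3 (two_mul_add_two_le_or_smallRank hn hbip hg
        hopen hTc (Set.nonempty_of_ncard_ne_zero (by omega)))
      omega

end Main

end GenPolygon

/-- A finite open partial n-gon containing a 2k-cycle with k > n
satisfies δₙ ≥ 2n + 2. -/
theorem delta_ge_of_long_cycle {n : ℕ} (hn : 3 ≤ n) {V : Type u} [Finite V]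
    (G : SimpleGraph V)
    (hpartial : GenPolygon.IsPartialGon n G) (hopen : GenPolygon.IsOpenGraph n G)
    (k : ℕ) (hk : n < k) (v : V) (c : G.Walk v v) (hc : c.IsCycle)
    (hlen : c.length = 2 * k) :
    2 * (n : ℤ) + 2 ≤ GenPolygon.delta n G Set.univ := by
  refine GenPolygon.two_mul_add_two_le_delta hn hpartial.2.1 hpartial.2.2 hopen ?_ hc
    (fun u _ => Set.mem_univ u) (by omega)
  intro x _ y _
  obtain ⟨w⟩ := hpartial.1.preconnected x y
  exact ⟨w, fun u _ => Set.mem_univ u⟩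
end
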